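/- arXiv:2402.13794 — 4 statements merged into one kernel-verified Lean document; each statement's English description precedes it below -/
import Mathlib

section
/- Fix an integer T ≥ 1 and δ ∈ (0,1). In the stochastic AdaGrad-with-momentum setting with f L-smooth and bounded below and assumptions (A2), (A3), for any β ∈ [0,1) and η, ε > 0, with probability at least 1 − δ one has (1/T)·Σ_{s=1}^T ‖∇f(x_s)‖² ≤ 2·Δ₁·[ (B₁·Δ₁ + G + ε)/T + √(2(A·Δ + C)/T) ], where Δ, Δ₁, B₁, G are the explicit constants defined from the problem parameters. -/
open MeasureTheory Finset Real

section Smooth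

variable {E : Type*} [NormedAddCommGroup E] [InnerProductSpace ℝ E] [CompleteSpace E]
  {f : E → ℝ} {f' : E → E} {L c : ℝ}

/-- The quadratic upper bound for functions with Lipschitz gradient. -/
theorem le_add_inner_gradient_add_sq (hgrad : ∀ p, HasGradientAt f (f' p) p)
    (hsmooth : ∀ p q, ‖f' p - f' q‖ ≤ L * ‖p - q‖) (p q : E) :
    f q ≤ f p + inner ℝ (f' p) (q - p) + L / 2 * ‖q - p‖ ^ 2 := by
  set w := q - p with hw
  let φ : ℝ → ℝ := fun t => f (p + t • w) - t * inner ℝ (f' p) w - L / 2 * t ^ 2 * ‖w‖ ^ 2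
  have hφ : ∀ t, HasDerivAt φ
      (inner ℝ (f' (p + t • w)) w - inner ℝ (f' p) w - L * t * ‖w‖ ^ 2) t := by
    intro t
    have hline : HasDerivAt (fun t : ℝ => p + t • w) w t := by
      simpa using ((hasDerivAt_id t).smul_const w).const_add p
    have hcomp := (hgrad (p + t • w)).hasFDerivAt.comp_hasDerivAt t hline
    have hquad := (((hasDerivAt_id t).pow 2).const_mul (L / 2)).mul_const (‖w‖ ^ 2)
    have hlin := (hasDerivAt_id t).mul_const (inner ℝ (f' p) w)
    refine ((hcomp.sub hlin).sub hquad).congr_deriv ?_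
    simp only [InnerProductSpace.toDual_apply_apply, id]
    push_cast
    ring
  have hanti : AntitoneOn φ (Set.Icc 0 1) := by
    refine antitoneOn_of_deriv_nonpos (convex_Icc 0 1)
      (fun t _ => (hφ t).continuousAt.continuousWithinAt)
      (fun t _ => (hφ t).differentiableAt.differentiableWithinAt) fun t ht => ?_
    rw [interior_Icc] at ht
    rw [(hφ t).deriv]
    have h1 : inner ℝ (f' (p + t • w) - f' p) w ≤ ‖f' (p + t • w) - f' p‖ * ‖w‖ :=
      real_inner_le_norm _ _
    have h2 : ‖f' (p + t • w) - f' p‖ ≤ L * (t * ‖w‖) := by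
      simpa [norm_smul, abs_of_pos ht.1] using hsmooth (p + t • w) p
    rw [inner_sub_left] at h1
    nlinarith [mul_le_mul_of_nonneg_right h2 (norm_nonneg w)]
  have h := hanti (Set.left_mem_Icc.2 zero_le_one) (Set.right_mem_Icc.2 zero_le_one) zero_le_one
  simp only [φ, hw, one_smul, zero_smul, add_sub_cancel, add_zero] at h
  rw [hw]
  linarith

/-- Self-bounding property of smooth functions that are bounded below. -/
theorem norm_gradient_sq_le (hgrad : ∀ p, HasGradientAt f (f' p) p)
    (hsmooth : ∀ p q, ‖f' p - f' q‖ ≤ L * ‖p - q‖) (hL : 0 < L) (hc : ∀ p, c ≤ f p) (p : E) :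
    ‖f' p‖ ^ 2 ≤ 2 * L * (f p - c) := by
  have h := le_add_inner_gradient_add_sq hgrad hsmooth p (p - (1 / L) • f' p)
  have hc' := hc (p - (1 / L) • f' p)
  rw [sub_sub_cancel_left, inner_neg_right, real_inner_smul_right, real_inner_self_eq_norm_sq,
    norm_neg, norm_smul, mul_pow, Real.norm_eq_abs, sq_abs] at h
  have e : L / 2 * ((1 / L) ^ 2 * ‖f' p‖ ^ 2) = 1 / L * ‖f' p‖ ^ 2 / 2 := by
    field_simp
  rw [e] at h
  have h3 : 1 / L * ‖f' p‖ ^ 2 ≤ 2 * (f p - c) := by linarith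
  rw [one_div, inv_mul_le_iff₀ hL] at h3
  linarith

/-- Moving from `p` to `q` at most doubles the optimality gap, up to a quadratic error. -/
theorem gap_le_two_mul_gap_add_sq (hgrad : ∀ p, HasGradientAt f (f' p) p)
    (hsmooth : ∀ p q, ‖f' p - f' q‖ ≤ L * ‖p - q‖) (hL : 0 < L) (hc : ∀ p, c ≤ f p) (p q : E) :
    f q - c ≤ 2 * (f p - c) + L * ‖q - p‖ ^ 2 := by
  have h := le_add_inner_gradient_add_sq hgrad hsmooth p q
  have h1 := norm_gradient_sq_le hgrad hsmooth hL hc p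
  have h2 := real_inner_le_norm (f' p) (q - p)
  have h3 : ‖f' p‖ * ‖q - p‖ ≤ (f p - c) + L / 2 * ‖q - p‖ ^ 2 := by
    have h4 : L * (‖f' p‖ * ‖q - p‖) ≤ L * ((f p - c) + L / 2 * ‖q - p‖ ^ 2) := by
      nlinarith [sq_nonneg (‖f' p‖ - L * ‖q - p‖)]
    exact le_of_mul_le_mul_left h4 hL
  linarith

end Smooth

section Run

/-- A trajectory of AdaGrad with momentum; the initial point is `x 1`. -/
structure IsAdaGradRun {d : ℕ} (β η ε : ℝ) (g v m x : ℕ → EuclideanSpace ℝ (Fin d)) : Prop where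
  v_zero : v 0 = 0
  m_zero : m 0 = 0
  v_succ : ∀ s i, v (s + 1) i = v s i + g (s + 1) i ^ 2
  m_succ : ∀ s i, m (s + 1) i = β * m s i - η * g (s + 1) i / (√(v (s + 1) i) + ε)
  x_succ : ∀ s, x (s + 2) = x (s + 1) + m (s + 1)

/-- The AdaGrad direction `g / (√v + ε)`, computed coordinatewise. -/
noncomputable def adaGradDir {d : ℕ} (ε : ℝ) (g v : EuclideanSpace ℝ (Fin d)) :
    EuclideanSpace ℝ (Fin d) :=
  WithLp.toLp 2 fun i => g i / (√(v i) + ε)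

/-- The surrogate direction `h / (√(v + G²) + ε)`, computed coordinatewise. -/
noncomputable def surrogateDir {d : ℕ} (G ε : ℝ) (v h : EuclideanSpace ℝ (Fin d)) :
    EuclideanSpace ℝ (Fin d) :=
  WithLp.toLp 2 fun i => h i / (√(v i + G ^ 2) + ε)

theorem euclidean_inner_eq_sum {d : ℕ} (p q : EuclideanSpace ℝ (Fin d)) :
    inner ℝ p q = ∑ i, p i * q i := by
  simp [PiLp.inner_apply, mul_comm]

/-- Replacing the AdaGrad step size by its surrogate, in one coordinate. -/
theorem neg_mul_div_le_surrogate {v g h G ε : ℝ} (hv : 0 ≤ v) (hG : 0 < G) (hε : 0 < ε)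
    (hg : g ^ 2 ≤ G ^ 2) :
    -(h * (g / (√(v + g ^ 2) + ε))) ≤
      -(3 / 4 * (h * (h / (√(v + G ^ 2) + ε)))) - h / (√(v + G ^ 2) + ε) * (g - h) +
        G * (g / (√(v + g ^ 2) + ε)) ^ 2 := by
  set a := √(v + G ^ 2) + ε with ha
  set b := √(v + g ^ 2) + ε with hb
  have hb0 : 0 < b := by positivity
  have hba : b ≤ a := by
    have : √(v + g ^ 2) ≤ √(v + G ^ 2) := Real.sqrt_le_sqrt (by linarith)
    linarith
  have hab : a - b ≤ G := by
    have h1 : √(v + G ^ 2) ≤ √v + G := by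
      rw [Real.sqrt_le_left (by positivity)]
      nlinarith [Real.sq_sqrt hv, mul_nonneg (Real.sqrt_nonneg v) hG.le]
    have h2 : √v ≤ √(v + g ^ 2) := Real.sqrt_le_sqrt (by nlinarith [sq_nonneg g])
    linarith
  have hGa : G ≤ a := by
    have : G ≤ √(v + G ^ 2) := Real.le_sqrt_of_sq_le (by linarith)
    linarith
  have ha0 : 0 < a := hb0.trans_le hba
  clear_value a b
  set u := g / b with hu
  have hgu : g = u * b := by rw [hu]; field_simp
  have key : -(h * u * (a - b)) ≤ h ^ 2 / 4 + G * a * u ^ 2 := by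
    have h1 : (a - b) ^ 2 ≤ G * a := by nlinarith
    nlinarith [sq_nonneg (h / 2 + u * (a - b)), mul_le_mul_of_nonneg_right h1 (sq_nonneg u)]
  have h2 : -(h * u) * a ≤ (-(3 / 4 * (h * (h / a))) - h / a * (g - h) + G * u ^ 2) * a := by
    have e : (-(3 / 4 * (h * (h / a))) - h / a * (g - h) + G * u ^ 2) * a =
        h ^ 2 / 4 - h * g + G * a * u ^ 2 := by
      field_simp
      ring
    rw [e, hgu]
    linarith
  exact le_of_mul_le_mul_right h2 ha0

variable {d : ℕ} {β η ε : ℝ} {g v m x : ℕ → EuclideanSpace ℝ (Fin d)}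

namespace IsAdaGradRun

theorem v_eq_sum (h : IsAdaGradRun β η ε g v m x) (t : ℕ) (i : Fin d) :
    v t i = ∑ s ∈ range t, g (s + 1) i ^ 2 := by
  induction t with
  | zero => simp [h.v_zero]
  | succ t ih => rw [h.v_succ, sum_range_succ, ih]

theorem v_nonneg (h : IsAdaGradRun β η ε g v m x) (t : ℕ) (i : Fin d) : 0 ≤ v t i := by
  rw [h.v_eq_sum]
  exact sum_nonneg fun _ _ => sq_nonneg _

theorem v_le_sum_norm_sq (h : IsAdaGradRun β η ε g v m x) {s t : ℕ} (hst : s ≤ t) (i : Fin d) :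
    v s i ≤ ∑ s ∈ range t, ‖g (s + 1)‖ ^ 2 := by
  rw [h.v_eq_sum]
  calc ∑ s ∈ range s, g (s + 1) i ^ 2 ≤ ∑ s ∈ range t, g (s + 1) i ^ 2 :=
        sum_le_sum_of_subset_of_nonneg (range_mono hst) fun _ _ _ => sq_nonneg _
    _ ≤ _ := sum_le_sum fun s _ => by
        rw [EuclideanSpace.real_norm_sq_eq]
        exact single_le_sum (f := fun i => g (s + 1) i ^ 2) (fun _ _ => sq_nonneg _) (mem_univ i)

theorem m_succ_eq (h : IsAdaGradRun β η ε g v m x) (s : ℕ) :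
    m (s + 1) = β • m s - η • adaGradDir ε (g (s + 1)) (v (s + 1)) := by
  ext i
  rw [h.m_succ]
  simp [adaGradDir, mul_div_assoc]

theorem norm_dir_le (h : IsAdaGradRun β η ε g v m x) (hε : 0 < ε) (s : ℕ) :
    ‖adaGradDir ε (g (s + 1)) (v (s + 1))‖ ≤ √d := by
  refine Real.le_sqrt_of_sq_le ?_
  rw [EuclideanSpace.real_norm_sq_eq]
  calc ∑ i, adaGradDir ε (g (s + 1)) (v (s + 1)) i ^ 2 ≤ ∑ _i : Fin d, (1 : ℝ) := by
        refine sum_le_sum fun i _ => ?_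
        have hv := h.v_nonneg s i
        have h1 : |g (s + 1) i| ≤ √(v (s + 1) i) := by
          refine Real.abs_le_sqrt ?_
          rw [h.v_succ]
          linarith
        have h2 : 0 < √(v (s + 1) i) + ε := by positivity
        rw [sq_le_one_iff_abs_le_one, adaGradDir, abs_div, abs_of_pos h2, div_le_one h2]
        linarith
    _ = d := by simp

theorem norm_m_le (h : IsAdaGradRun β η ε g v m x) (hβ0 : 0 ≤ β) (hβ1 : β < 1) (hη : 0 < η)
    (hε : 0 < ε) (s : ℕ) : ‖m s‖ ≤ η * √d / (1 - β) := by
  have hβ : 0 < 1 - β := sub_pos.2 hβ1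
  induction s with
  | zero => simp only [h.m_zero, norm_zero]; positivity
  | succ s ih =>
    rw [h.m_succ_eq]
    calc _ ≤ β * ‖m s‖ + η * ‖adaGradDir ε (g (s + 1)) (v (s + 1))‖ := by
          refine (norm_sub_le _ _).trans_eq ?_
          simp [norm_smul, abs_of_nonneg hβ0, abs_of_pos hη]
      _ ≤ β * (η * √d / (1 - β)) + η * √d := by
          gcongr
          exact h.norm_dir_le hε s
      _ = _ := by field_simp; ring

theorem norm_x_sub_le (h : IsAdaGradRun β η ε g v m x) (hβ0 : 0 ≤ β) (hβ1 : β < 1) (hη : 0 < η)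
    (hε : 0 < ε) (s : ℕ) : ‖x (s + 1) - x 1‖ ≤ s * (η * √d / (1 - β)) := by
  induction s with
  | zero => simp
  | succ s ih =>
    have e : x (s + 1 + 1) - x 1 = (x (s + 1) - x 1) + m (s + 1) := by
      rw [h.x_succ]; abel
    rw [e]
    push_cast
    linarith [norm_add_le (x (s + 1) - x 1) (m (s + 1)), h.norm_m_le hβ0 hβ1 hη hε (s + 1)]

theorem norm_m_succ_sq_le (h : IsAdaGradRun β η ε g v m x) (hβ0 : 0 ≤ β) (hβ1 : β < 1)
    (hη : 0 < η) (s : ℕ) :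
    ‖m (s + 1)‖ ^ 2 ≤ β * ‖m s‖ ^ 2 +
      η ^ 2 / (1 - β) * ‖adaGradDir ε (g (s + 1)) (v (s + 1))‖ ^ 2 := by
  have hβ : 0 < 1 - β := sub_pos.2 hβ1
  rw [h.m_succ_eq]
  set u := adaGradDir ε (g (s + 1)) (v (s + 1))
  have h1 : ‖β • m s - η • u‖ ≤ β * ‖m s‖ + (1 - β) * (η / (1 - β) * ‖u‖) := by
    refine (norm_sub_le _ _).trans_eq ?_
    rw [norm_smul, norm_smul, Real.norm_eq_abs, Real.norm_eq_abs, abs_of_nonneg hβ0, abs_of_pos hη]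
    field_simp
  have e : η ^ 2 / (1 - β) * ‖u‖ ^ 2 = (1 - β) * (η / (1 - β) * ‖u‖) ^ 2 := by
    field_simp
  rw [e]
  generalize η / (1 - β) * ‖u‖ = r at *
  calc _ ≤ (β * ‖m s‖ + (1 - β) * r) ^ 2 := by gcongr
    _ ≤ _ := by nlinarith [mul_nonneg (mul_nonneg hβ0 hβ.le) (sq_nonneg (‖m s‖ - r))]

theorem norm_m_sq_le (h : IsAdaGradRun β η ε g v m x) (hβ0 : 0 ≤ β) (hβ1 : β < 1)
    (hη : 0 < η) (t : ℕ) :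
    ‖m t‖ ^ 2 ≤ η ^ 2 / (1 - β) *
      ∑ s ∈ range t, ‖adaGradDir ε (g (s + 1)) (v (s + 1))‖ ^ 2 := by
  induction t with
  | zero => simp [h.m_zero]
  | succ t ih =>
    rw [sum_range_succ, mul_add]
    nlinarith [h.norm_m_succ_sq_le hβ0 hβ1 hη t, sq_nonneg ‖m t‖]

theorem sum_norm_dir_sq_le (h : IsAdaGradRun β η ε g v m x) (hε : 0 < ε) (t : ℕ) :
    ∑ s ∈ range t, ‖adaGradDir ε (g (s + 1)) (v (s + 1))‖ ^ 2 ≤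
      d * log (1 + 1 / ε ^ 2 * ∑ s ∈ range t, ‖g (s + 1)‖ ^ 2) := by
  have hcoord : ∀ i, ∀ t, ∑ s ∈ range t, adaGradDir ε (g (s + 1)) (v (s + 1)) i ^ 2 ≤
      log (1 + 1 / ε ^ 2 * v t i) := by
    intro i t
    induction t with
    | zero => simp [h.v_zero]
    | succ t ih =>
      have hv := h.v_nonneg t i
      have hv' := h.v_nonneg (t + 1) i
      have p1 : 0 < 1 + 1 / ε ^ 2 * v t i := by positivity
      have p2 : 0 < 1 + 1 / ε ^ 2 * v (t + 1) i := by positivity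
      have h1 := Real.one_sub_inv_le_log_of_pos (div_pos p2 p1)
      rw [Real.log_div p2.ne' p1.ne', inv_div] at h1
      have h2 : adaGradDir ε (g (t + 1)) (v (t + 1)) i ^ 2 ≤
          1 - (1 + 1 / ε ^ 2 * v t i) / (1 + 1 / ε ^ 2 * v (t + 1) i) := by
        have e : 1 - (1 + 1 / ε ^ 2 * v t i) / (1 + 1 / ε ^ 2 * v (t + 1) i) =
            g (t + 1) i ^ 2 / (v (t + 1) i + ε ^ 2) := by
          have : 0 < v (t + 1) i + ε ^ 2 := by positivity
          rw [eq_div_iff this.ne', sub_mul, div_mul_eq_mul_div, sub_eq_iff_eq_add]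
          rw [← sub_eq_iff_eq_add', eq_div_iff p2.ne']
          field_simp
          rw [h.v_succ]
          ring
        rw [e, adaGradDir, div_pow]
        gcongr
        nlinarith [Real.sq_sqrt hv', Real.sqrt_nonneg (v (t + 1) i)]
      rw [sum_range_succ]
      linarith
  calc _ = ∑ i, ∑ s ∈ range t, adaGradDir ε (g (s + 1)) (v (s + 1)) i ^ 2 := by
        rw [sum_comm]
        exact sum_congr rfl fun s _ => EuclideanSpace.real_norm_sq_eq _
    _ ≤ ∑ _i : Fin d, log (1 + 1 / ε ^ 2 * ∑ s ∈ range t, ‖g (s + 1)‖ ^ 2) := by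
        refine sum_le_sum fun i _ => (hcoord i t).trans ?_
        have hv := h.v_nonneg t i
        refine Real.log_le_log (by positivity) ?_
        gcongr
        exact h.v_le_sum_norm_sq le_rfl i
    _ = _ := by simp

theorem neg_inner_dir_le (h : IsAdaGradRun β η ε g v m x) {G : ℝ} (hG : 0 < G) (hε : 0 < ε)
    (s : ℕ) (hg : ‖g (s + 1)‖ ≤ G) (w : EuclideanSpace ℝ (Fin d)) :
    -inner ℝ w (adaGradDir ε (g (s + 1)) (v (s + 1))) ≤
      -(3 / 4 * inner ℝ w (surrogateDir G ε (v s) w)) -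
        inner ℝ (surrogateDir G ε (v s) w) (g (s + 1) - w) +
        G * ‖adaGradDir ε (g (s + 1)) (v (s + 1))‖ ^ 2 := by
  rw [EuclideanSpace.real_norm_sq_eq]
  simp only [euclidean_inner_eq_sum, mul_sum, ← sum_neg_distrib, ← sum_sub_distrib,
    ← sum_add_distrib]
  refine sum_le_sum fun i _ => ?_
  have hgi : g (s + 1) i ^ 2 ≤ G ^ 2 := by
    have h1 : g (s + 1) i ^ 2 ≤ ‖g (s + 1)‖ ^ 2 := by
      rw [EuclideanSpace.real_norm_sq_eq]
      exact single_le_sum (f := fun i => g (s + 1) i ^ 2) (fun _ _ => sq_nonneg _) (mem_univ i)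
    exact h1.trans (by gcongr)
  have := neg_mul_div_le_surrogate (h := w i) (h.v_nonneg s i) hG hε hgi
  simpa only [adaGradDir, surrogateDir, h.v_succ, PiLp.sub_apply] using this

variable {f : EuclideanSpace ℝ (Fin d) → ℝ}
  {f' : EuclideanSpace ℝ (Fin d) → EuclideanSpace ℝ (Fin d)} {L c : ℝ}

theorem gap_le_growth (h : IsAdaGradRun β η ε g v m x) (hβ0 : 0 ≤ β) (hβ1 : β < 1) (hη : 0 < η)
    (hε : 0 < ε) (hgrad : ∀ p, HasGradientAt f (f' p) p)
    (hsmooth : ∀ p q, ‖f' p - f' q‖ ≤ L * ‖p - q‖) (hL : 0 < L) {s T : ℕ} (hs : s ≤ T) :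
    f (x (s + 1)) - c ≤ f (x 1) - c + η * ‖f' (x 1)‖ * √d / (1 - β) * T +
      L * η ^ 2 * d / (2 * (1 - β) ^ 2) * T ^ 2 := by
  have hβ : 0 < 1 - β := sub_pos.2 hβ1
  have hsT : (s : ℝ) ≤ T := by exact_mod_cast hs
  have h1 := le_add_inner_gradient_add_sq hgrad hsmooth (x 1) (x (s + 1))
  have h2 : ‖x (s + 1) - x 1‖ ≤ T * (η * √d / (1 - β)) :=
    (h.norm_x_sub_le hβ0 hβ1 hη hε s).trans (by gcongr)
  have h3 : inner ℝ (f' (x 1)) (x (s + 1) - x 1) ≤ ‖f' (x 1)‖ * (T * (η * √d / (1 - β))) :=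
    (real_inner_le_norm _ _).trans (by gcongr)
  have h4 : L / 2 * ‖x (s + 1) - x 1‖ ^ 2 ≤ L / 2 * (T * (η * √d / (1 - β))) ^ 2 := by gcongr
  have e3 : ‖f' (x 1)‖ * (T * (η * √d / (1 - β))) = η * ‖f' (x 1)‖ * √d / (1 - β) * T := by
    ring
  have e4 : L / 2 * (T * (η * √d / (1 - β))) ^ 2 =
      L * η ^ 2 * d / (2 * (1 - β) ^ 2) * T ^ 2 := by
    rw [mul_pow, div_pow, mul_pow, Real.sq_sqrt d.cast_nonneg]
    field_simp
  linarith

theorem norm_sum_sq_growth (h : IsAdaGradRun β η ε g v m x) (hβ0 : 0 ≤ β) (hβ1 : β < 1)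
    (hη : 0 < η) (hε : 0 < ε) (hgrad : ∀ p, HasGradientAt f (f' p) p)
    (hsmooth : ∀ p q, ‖f' p - f' q‖ ≤ L * ‖p - q‖) (hL : 0 < L) {X C : ℝ} (hX : 0 ≤ X) {T : ℕ}
    (hg : ∀ s < T, ‖g (s + 1)‖ ^ 2 ≤ X * (f (x (s + 1)) - c) + 2 * C) :
    ∑ s ∈ range T, ‖g (s + 1)‖ ^ 2 ≤
      (X * (f (x 1) - c) + 2 * C) * T +
        (η * ‖f' (x 1)‖ * √d / (1 - β) + L * η ^ 2 * d / (2 * (1 - β) ^ 2)) * X * T ^ 2 +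
        L * η ^ 2 * d * X * T ^ 3 / (1 - β) ^ 2 := by
  have hβ : 0 < 1 - β := sub_pos.2 hβ1
  have h1 : ∀ s ∈ range T, ‖g (s + 1)‖ ^ 2 ≤ X * (f (x 1) - c +
      η * ‖f' (x 1)‖ * √d / (1 - β) * T + L * η ^ 2 * d / (2 * (1 - β) ^ 2) * T ^ 2) + 2 * C := by
    intro s hs
    refine (hg s (mem_range.1 hs)).trans ?_
    gcongr
    exact h.gap_le_growth hβ0 hβ1 hη hε hgrad hsmooth hL (mem_range.1 hs).le
  have h2 := sum_le_sum h1
  rw [sum_const, card_range, nsmul_eq_mul] at h2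
  have e : (T : ℝ) * (X * (f (x 1) - c + η * ‖f' (x 1)‖ * √d / (1 - β) * T +
      L * η ^ 2 * d / (2 * (1 - β) ^ 2) * T ^ 2) + 2 * C) =
      (X * (f (x 1) - c) + 2 * C) * T + η * ‖f' (x 1)‖ * √d / (1 - β) * X * T ^ 2 +
        1 / 2 * (L * η ^ 2 * d * X * T ^ 3 / (1 - β) ^ 2) := by
    field_simp
    ring
  have p1 : 0 ≤ L * η ^ 2 * d * X * T ^ 3 / (1 - β) ^ 2 := by positivity
  have p2 : 0 ≤ L * η ^ 2 * d / (2 * (1 - β) ^ 2) * X * T ^ 2 := by positivity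
  linarith

/-- The descent inequality along the auxiliary sequence `x + β / (1 - β) • m`. -/
theorem potential_le (h : IsAdaGradRun β η ε g v m x) (hβ0 : 0 ≤ β) (hβ1 : β < 1)
    (hη : 0 < η) (hgrad : ∀ p, HasGradientAt f (f' p) p)
    (hsmooth : ∀ p q, ‖f' p - f' q‖ ≤ L * ‖p - q‖) (hL : 0 < L) (t : ℕ) :
    f (x (t + 1) + (β / (1 - β)) • m t) + L * β / (2 * (1 - β) ^ 2) * ‖m t‖ ^ 2 ≤
      f (x 1) +
        η / (1 - β) * ∑ s ∈ range t,
          -inner ℝ (f' (x (s + 1))) (adaGradDir ε (g (s + 1)) (v (s + 1))) +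
        (L * β * η ^ 2 / (1 - β) ^ 3 + L * η ^ 2 / (2 * (1 - β) ^ 2)) *
          ∑ s ∈ range t, ‖adaGradDir ε (g (s + 1)) (v (s + 1))‖ ^ 2 := by
  have hβ : 0 < 1 - β := sub_pos.2 hβ1
  induction t with
  | zero => simp [h.m_zero]
  | succ t ih =>
    rw [sum_range_succ, sum_range_succ]
    have hm := h.norm_m_succ_sq_le hβ0 hβ1 hη t
    have hmu := h.m_succ_eq t
    set u := adaGradDir ε (g (t + 1)) (v (t + 1))
    set y := x (t + 1) + (β / (1 - β)) • m t with hy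
    have hstep : x (t + 1 + 1) + (β / (1 - β)) • m (t + 1) = y - (η / (1 - β)) • u := by
      ext i
      rw [h.x_succ, hmu, hy]
      simp
      field_simp
      ring
    have hdesc := le_add_inner_gradient_add_sq hgrad hsmooth y (y - (η / (1 - β)) • u)
    rw [sub_sub_cancel_left, inner_neg_right, real_inner_smul_right, norm_neg, norm_smul, mul_pow,
      Real.norm_eq_abs, sq_abs] at hdesc
    have hlip : ‖f' y - f' (x (t + 1))‖ ≤ L * (β / (1 - β) * ‖m t‖) := by
      refine (hsmooth _ _).trans_eq ?_
      rw [hy, add_sub_cancel_left, norm_smul, Real.norm_of_nonneg (by positivity)]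
    have hcross : -inner ℝ (f' y - f' (x (t + 1))) u ≤ L * (β / (1 - β) * ‖m t‖) * ‖u‖ :=
      (neg_le_abs _).trans ((abs_real_inner_le_norm _ _).trans (by gcongr))
    rw [inner_sub_left] at hcross
    have hcross' := mul_le_mul_of_nonneg_left hcross (by positivity : 0 ≤ η / (1 - β))
    have hyoung : η / (1 - β) * (L * (β / (1 - β) * ‖m t‖) * ‖u‖) ≤
        L * β / (2 * (1 - β)) * ‖m t‖ ^ 2 + L * β * η ^ 2 / (2 * (1 - β) ^ 3) * ‖u‖ ^ 2 := by
      have e : L * β / (2 * (1 - β)) * ‖m t‖ ^ 2 + L * β * η ^ 2 / (2 * (1 - β) ^ 3) * ‖u‖ ^ 2 -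
          η / (1 - β) * (L * (β / (1 - β) * ‖m t‖) * ‖u‖) =
          L * β / (2 * (1 - β)) * (‖m t‖ - η / (1 - β) * ‖u‖) ^ 2 := by
        field_simp
        ring
      have : 0 ≤ L * β / (2 * (1 - β)) * (‖m t‖ - η / (1 - β) * ‖u‖) ^ 2 := by positivity
      linarith
    have hm' := mul_le_mul_of_nonneg_left hm (by positivity : 0 ≤ L * β / (2 * (1 - β) ^ 2))
    have e1 : L * β / (2 * (1 - β) ^ 2) * (β * ‖m t‖ ^ 2 + η ^ 2 / (1 - β) * ‖u‖ ^ 2) =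
        L * β / (2 * (1 - β) ^ 2) * ‖m t‖ ^ 2 - L * β / (2 * (1 - β)) * ‖m t‖ ^ 2 +
          L * β * η ^ 2 / (2 * (1 - β) ^ 3) * ‖u‖ ^ 2 := by
      field_simp
      ring
    have e2 : (L * β * η ^ 2 / (1 - β) ^ 3 + L * η ^ 2 / (2 * (1 - β) ^ 2)) * ‖u‖ ^ 2 =
        2 * (L * β * η ^ 2 / (2 * (1 - β) ^ 3) * ‖u‖ ^ 2) +
          L / 2 * ((η / (1 - β)) ^ 2 * ‖u‖ ^ 2) := by
      field_simp
    rw [hstep, mul_add, mul_add, e2]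
    linarith

end IsAdaGradRun

end Run

section Bounds

/-- The constant `Δ` dominates the right-hand side of the summed descent inequality. -/
theorem adaGrad_bound_le {β η L X C Δ G N ℓ Δ₀ n l : ℝ} (hβ0 : 0 ≤ β) (hβ1 : β < 1)
    (hη : 0 < η) (hL : 0 < L) (hX : 0 ≤ X) (hC : 0 < C) (hΔ₀ : 0 ≤ Δ₀) (hℓ : 0 ≤ ℓ) (hn : 0 ≤ n)
    (hl : 0 ≤ l) (hN : N = n * l)
    (hΔ : Δ = 4 * Δ₀ + 12 * √(2 * C) * η / (1 - β) * ℓ +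
      4 * (√(2 * C) * η / (1 - β) + L * η ^ 2 / (1 - β) ^ 3 +
        (L * η ^ 2 / (2 * (1 - β) ^ 3) + L * η ^ 2 / (2 * (1 - β) ^ 2))) * n * l +
      72 * X * η ^ 2 / (1 - β) ^ 2 * ℓ ^ 2 + 8 * X * η ^ 2 / (1 - β) ^ 2 * n ^ 2 * l ^ 2)
    (hG : G = √(X * Δ + 2 * C)) :
    2 * (Δ₀ + 3 * (η / (1 - β)) * G * ℓ + (η / (1 - β) * G +
      (L * β * η ^ 2 / (1 - β) ^ 3 + L * η ^ 2 / (2 * (1 - β) ^ 2))) * N) +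
      L * β ^ 2 * η ^ 2 / (1 - β) ^ 3 * N ≤ Δ := by
  have hβ : 0 < 1 - β := sub_pos.2 hβ1
  have hN0 : 0 ≤ N := hN ▸ mul_nonneg hn hl
  have hΔ0 : 0 ≤ Δ := by rw [hΔ]; positivity
  have hG' : G ≤ √X * √Δ + √(2 * C) := by
    rw [hG, ← Real.sqrt_mul hX, Real.sqrt_le_left (by positivity), add_sq,
      Real.sq_sqrt (by positivity), Real.sq_sqrt (by positivity)]
    have : 0 ≤ √(X * Δ) * √(2 * C) := by positivity
    linarith
  set D := η / (1 - β) with hD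
  have hD0 : 0 < D := by positivity
  set K := L * η ^ 2 / (1 - β) ^ 3 with hK
  set M := L * η ^ 2 / (2 * (1 - β) ^ 2) with hM
  have hK0 : 0 < K := by positivity
  have e1 : L * β * η ^ 2 / (1 - β) ^ 3 = β * K := by rw [hK]; ring
  have e2 : L * β ^ 2 * η ^ 2 / (1 - β) ^ 3 = β ^ 2 * K := by rw [hK]; ring
  have e3 : L * η ^ 2 / (2 * (1 - β) ^ 3) = K / 2 := by rw [hK]; field_simp
  have e4 : 12 * √(2 * C) * η / (1 - β) * ℓ = 12 * √(2 * C) * D * ℓ := by rw [hD]; ring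
  have e5 : √(2 * C) * η / (1 - β) = √(2 * C) * D := by rw [hD]; ring
  have e6 : 72 * X * η ^ 2 / (1 - β) ^ 2 * ℓ ^ 2 = 72 * X * D ^ 2 * ℓ ^ 2 := by
    rw [hD, div_pow]; ring
  have e7 : 8 * X * η ^ 2 / (1 - β) ^ 2 * n ^ 2 * l ^ 2 = 8 * X * D ^ 2 * N ^ 2 := by
    rw [hD, div_pow, hN]; ring
  rw [e3, e4, e5, e6, e7, mul_assoc _ n l, ← hN] at hΔ
  rw [e1, e2]
  clear_value D K M
  have hsX := Real.sq_sqrt hX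
  have hsΔ := Real.sq_sqrt hΔ0
  have h1 : 6 * D * (√X * √Δ) * ℓ ≤ Δ / 4 + 36 * X * D ^ 2 * ℓ ^ 2 := by
    have e : (√Δ / 2 - 6 * √X * D * ℓ) ^ 2 =
        √Δ ^ 2 / 4 - 6 * D * (√X * √Δ) * ℓ + 36 * √X ^ 2 * D ^ 2 * ℓ ^ 2 := by ring
    rw [hsX, hsΔ] at e
    linarith [sq_nonneg (√Δ / 2 - 6 * √X * D * ℓ)]
  have h2 : 2 * D * (√X * √Δ) * N ≤ Δ / 4 + 4 * X * D ^ 2 * N ^ 2 := by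
    have e : (√Δ / 2 - 2 * √X * D * N) ^ 2 =
        √Δ ^ 2 / 4 - 2 * D * (√X * √Δ) * N + 4 * √X ^ 2 * D ^ 2 * N ^ 2 := by ring
    rw [hsX, hsΔ] at e
    linarith [sq_nonneg (√Δ / 2 - 2 * √X * D * N)]
  have h3 : 6 * D * G * ℓ ≤ 6 * D * (√X * √Δ + √(2 * C)) * ℓ := by gcongr
  have h4 : 2 * D * G * N ≤ 2 * D * (√X * √Δ + √(2 * C)) * N := by gcongr
  have hKN : 0 ≤ K * N := by positivity
  have h5 : β * (K * N) ≤ K * N := mul_le_of_le_one_left hKN hβ1.le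
  have h6 : β ^ 2 * (K * N) ≤ K * N := mul_le_of_le_one_left hKN (pow_le_one₀ hβ0 hβ1.le)
  linarith

/-- Solving the self-bounding inequality for the sum of squared gradients. -/
theorem sum_sq_le_of_self_bound {H W S₁ b e r : ℝ} (hH : 0 ≤ H) (hS₁ : 0 ≤ S₁) (hb : 0 ≤ b)
    (hr : 0 ≤ r) (hHW : H ≤ (√W + e) * S₁) (hW : W ≤ 2 * b * H + r) :
    H ≤ 2 * S₁ * (b * S₁ + e + √r) := by
  have h1 : √W ≤ √(2 * b * H) + √r := by
    refine (Real.sqrt_le_sqrt hW).trans ?_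
    rw [Real.sqrt_le_left (by positivity), add_sq, Real.sq_sqrt (by positivity), Real.sq_sqrt hr]
    have : 0 ≤ √(2 * b * H) * √r := by positivity
    linarith
  have h2 : √(2 * b * H) * S₁ ≤ H / 2 + b * S₁ ^ 2 := by
    rw [Real.sqrt_mul (by positivity)]
    have e1 := Real.sq_sqrt hH
    have e2 := Real.sq_sqrt (show 0 ≤ 2 * b by positivity)
    nlinarith [sq_nonneg (√H - √(2 * b) * S₁)]
  have h3 := mul_le_mul_of_nonneg_right h1 hS₁
  linarith

end Bounds

section Run

variable {d : ℕ} {β η ε : ℝ} {g v m x : ℕ → EuclideanSpace ℝ (Fin d)}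
  {f : EuclideanSpace ℝ (Fin d) → ℝ}
  {f' : EuclideanSpace ℝ (Fin d) → EuclideanSpace ℝ (Fin d)} {L c : ℝ}

/-- The noise level bound implies a bound on the stochastic gradient. -/
theorem norm_sq_le_of_noise {g h : EuclideanSpace ℝ (Fin d)} {A B C D L : ℝ} (hB : 0 < B)
    (hgap : ‖h‖ ^ 2 ≤ 2 * L * D) (hnoise : ‖g - h‖ ^ 2 ≤ A * D + B * ‖h‖ ^ 2 + C) :
    ‖g‖ ^ 2 ≤ (2 * A + 4 * L * B + 4 * L) * D + 2 * C := by
  have h1 : ‖g‖ ≤ ‖g - h‖ + ‖h‖ := by simpa using norm_add_le (g - h) h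
  have h2 : ‖g‖ ^ 2 ≤ 2 * ‖g - h‖ ^ 2 + 2 * ‖h‖ ^ 2 := by
    nlinarith [norm_nonneg g, sq_nonneg (‖g - h‖ - ‖h‖)]
  nlinarith [mul_le_mul_of_nonneg_left hgap hB.le]

theorem inner_surrogateDir_nonneg (G : ℝ) (hε : 0 < ε) (v h : EuclideanSpace ℝ (Fin d)) :
    0 ≤ inner ℝ h (surrogateDir G ε v h) := by
  rw [euclidean_inner_eq_sum]
  refine sum_nonneg fun i _ => ?_
  have : 0 < √(v i + G ^ 2) + ε := by positivity
  rw [surrogateDir, mul_div_assoc']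
  exact div_nonneg (mul_self_nonneg _) this.le

theorem norm_sq_le_mul_inner_surrogateDir {G W : ℝ} (hG : 0 < G) (hε : 0 < ε)
    {v : EuclideanSpace ℝ (Fin d)} (hv : ∀ i, 0 ≤ v i) (hW : ∀ i, v i ≤ W)
    (h : EuclideanSpace ℝ (Fin d)) :
    ‖h‖ ^ 2 ≤ (√W + (G + ε)) * inner ℝ h (surrogateDir G ε v h) := by
  rw [euclidean_inner_eq_sum, EuclideanSpace.real_norm_sq_eq, mul_sum]
  refine sum_le_sum fun i _ => ?_
  have hW0 : 0 ≤ W := (hv i).trans (hW i)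
  have h1 : √(v i + G ^ 2) ≤ √W + G := by
    rw [Real.sqrt_le_left (by positivity), add_sq, Real.sq_sqrt hW0]
    have := hW i
    have : 0 ≤ √W * G := by positivity
    linarith
  have hpos : 0 < √(v i + G ^ 2) + ε := by positivity
  have e : h i ^ 2 = (√(v i + G ^ 2) + ε) * (h i * surrogateDir G ε v h i) := by
    rw [surrogateDir]
    field_simp
  have hnn : 0 ≤ h i * surrogateDir G ε v h i := by
    rw [surrogateDir, mul_div_assoc']
    exact div_nonneg (mul_self_nonneg _) hpos.le
  rw [e]
  exact mul_le_mul_of_nonneg_right (by linarith) hnn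

namespace IsAdaGradRun

/-- One step of the induction: as long as the stochastic gradients are bounded by `G` and the
noise terms are under control, the optimality gap stays below `Δ`. -/
theorem gap_le_and_sum_le (h : IsAdaGradRun β η ε g v m x) (hβ0 : 0 ≤ β) (hβ1 : β < 1)
    (hη : 0 < η) (hε : 0 < ε) (hgrad : ∀ p, HasGradientAt f (f' p) p)
    (hsmooth : ∀ p q, ‖f' p - f' q‖ ≤ L * ‖p - q‖) (hL : 0 < L) (hc : ∀ p, c ≤ f p)
    {G N ℓ Δ : ℝ} (hG : 0 < G) {t : ℕ} (hg : ∀ s < t, ‖g (s + 1)‖ ≤ G)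
    (hN : ∑ s ∈ range t, ‖adaGradDir ε (g (s + 1)) (v (s + 1))‖ ^ 2 ≤ N)
    (hgood : ∑ s ∈ range t,
      (-inner ℝ (surrogateDir G ε (v s) (f' (x (s + 1)))) (g (s + 1) - f' (x (s + 1))) -
        1 / 4 * inner ℝ (f' (x (s + 1))) (surrogateDir G ε (v s) (f' (x (s + 1))))) ≤
      3 * G * ℓ)
    (hΔ : 2 * (f (x 1) - c + 3 * (η / (1 - β)) * G * ℓ + (η / (1 - β) * G +
      (L * β * η ^ 2 / (1 - β) ^ 3 + L * η ^ 2 / (2 * (1 - β) ^ 2))) * N) +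
      L * β ^ 2 * η ^ 2 / (1 - β) ^ 3 * N ≤ Δ) :
    f (x (t + 1)) - c ≤ Δ ∧
      η / (1 - β) * ∑ s ∈ range t,
        inner ℝ (f' (x (s + 1))) (surrogateDir G ε (v s) (f' (x (s + 1)))) ≤ Δ := by
  have hβ : 0 < 1 - β := sub_pos.2 hβ1
  have hD : 0 < η / (1 - β) := by positivity
  set S := ∑ s ∈ range t, ‖adaGradDir ε (g (s + 1)) (v (s + 1))‖ ^ 2 with hS
  set Q := ∑ s ∈ range t,
    inner ℝ (f' (x (s + 1))) (surrogateDir G ε (v s) (f' (x (s + 1)))) with hQ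
  have hS0 : 0 ≤ S := sum_nonneg fun _ _ => sq_nonneg _
  have hQ0 : 0 ≤ Q := sum_nonneg fun _ _ => inner_surrogateDir_nonneg G hε _ _
  have hinner : ∑ s ∈ range t,
      -inner ℝ (f' (x (s + 1))) (adaGradDir ε (g (s + 1)) (v (s + 1))) ≤
      3 * G * ℓ - 1 / 2 * Q + G * S := by
    calc _ ≤ ∑ s ∈ range t,
          ((-inner ℝ (surrogateDir G ε (v s) (f' (x (s + 1)))) (g (s + 1) - f' (x (s + 1))) -
            1 / 4 * inner ℝ (f' (x (s + 1))) (surrogateDir G ε (v s) (f' (x (s + 1))))) -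
            1 / 2 * inner ℝ (f' (x (s + 1))) (surrogateDir G ε (v s) (f' (x (s + 1)))) +
            G * ‖adaGradDir ε (g (s + 1)) (v (s + 1))‖ ^ 2) := by
          refine sum_le_sum fun s hs => ?_
          have := h.neg_inner_dir_le hG hε s (hg s (mem_range.1 hs)) (f' (x (s + 1)))
          linarith
      _ ≤ _ := by
          rw [sum_add_distrib, sum_sub_distrib, ← mul_sum, ← mul_sum, ← hS, ← hQ]
          linarith
  have hpot := h.potential_le hβ0 hβ1 hη hgrad hsmooth hL t
  rw [← hS] at hpot
  set y := x (t + 1) + (β / (1 - β)) • m t with hy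
  have hκ : 0 ≤ L * β / (2 * (1 - β) ^ 2) * ‖m t‖ ^ 2 := by positivity
  have h1 := mul_le_mul_of_nonneg_left hinner hD.le
  have h2 : (η / (1 - β) * G + (L * β * η ^ 2 / (1 - β) ^ 3 + L * η ^ 2 / (2 * (1 - β) ^ 2))) * S ≤
      (η / (1 - β) * G + (L * β * η ^ 2 / (1 - β) ^ 3 + L * η ^ 2 / (2 * (1 - β) ^ 2))) * N := by
    gcongr
  have hN0 : 0 ≤ N := hS0.trans hN
  have h3 : 0 ≤ L * β ^ 2 * η ^ 2 / (1 - β) ^ 3 * N := by positivity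
  have hDQ : 0 ≤ η / (1 - β) * Q := by positivity
  constructor
  · have hgap := gap_le_two_mul_gap_add_sq hgrad hsmooth hL hc y (x (t + 1))
    have hxy : L * ‖x (t + 1) - y‖ ^ 2 ≤ L * β ^ 2 * η ^ 2 / (1 - β) ^ 3 * N := by
      rw [hy, sub_add_cancel_left, norm_neg, norm_smul, mul_pow, Real.norm_eq_abs, sq_abs]
      calc L * ((β / (1 - β)) ^ 2 * ‖m t‖ ^ 2)
          ≤ L * ((β / (1 - β)) ^ 2 * (η ^ 2 / (1 - β) * N)) := by
            gcongr
            exact (h.norm_m_sq_le hβ0 hβ1 hη t).trans (by gcongr)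
        _ = _ := by field_simp
    linarith
  · have := hc y
    linarith

/-- The convergence guarantee along a trajectory on which the noise terms are under control. -/
theorem sum_norm_gradient_sq_le (h : IsAdaGradRun β η ε g v m x) (hβ0 : 0 ≤ β) (hβ1 : β < 1)
    (hη : 0 < η) (hε : 0 < ε) (hgrad : ∀ p, HasGradientAt f (f' p) p)
    (hsmooth : ∀ p q, ‖f' p - f' q‖ ≤ L * ‖p - q‖) (hL : 0 < L) (hc : ∀ p, c ≤ f p)
    {A B C G N ℓ Δ : ℝ} (hA : 0 < A) (hB : 0 < B) (hC : 0 < C) (hΔ0 : 0 ≤ Δ) {T : ℕ}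
    (hG : G = √((2 * A + 4 * L * B + 4 * L) * Δ + 2 * C))
    (hnoise : ∀ s < T, ‖g (s + 1) - f' (x (s + 1))‖ ^ 2 ≤
      A * (f (x (s + 1)) - c) + B * ‖f' (x (s + 1))‖ ^ 2 + C)
    (hN : ∑ s ∈ range T, ‖adaGradDir ε (g (s + 1)) (v (s + 1))‖ ^ 2 ≤ N)
    (hgood : ∀ t ≤ T, (∀ s < t, f (x (s + 1)) - c ≤ Δ) → ∑ s ∈ range t,
      (-inner ℝ (surrogateDir G ε (v s) (f' (x (s + 1)))) (g (s + 1) - f' (x (s + 1))) -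
        1 / 4 * inner ℝ (f' (x (s + 1))) (surrogateDir G ε (v s) (f' (x (s + 1))))) ≤
      3 * G * ℓ)
    (hΔ : 2 * (f (x 1) - c + 3 * (η / (1 - β)) * G * ℓ + (η / (1 - β) * G +
      (L * β * η ^ 2 / (1 - β) ^ 3 + L * η ^ 2 / (2 * (1 - β) ^ 2))) * N) +
      L * β ^ 2 * η ^ 2 / (1 - β) ^ 3 * N ≤ Δ) :
    ∑ s ∈ range T, ‖f' (x (s + 1))‖ ^ 2 ≤
      2 * (Δ * (1 - β) / η) * ((B + 1) * (Δ * (1 - β) / η) + (G + ε) +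
        √(2 * (A * Δ + C) * T)) := by
  have hβ : 0 < 1 - β := sub_pos.2 hβ1
  have hG0 : 0 < G := hG ▸ Real.sqrt_pos.2 (by positivity)
  have hgrad_sq := fun s => norm_gradient_sq_le hgrad hsmooth hL hc (x (s + 1))
  have hgG : ∀ s < T, f (x (s + 1)) - c ≤ Δ → ‖g (s + 1)‖ ≤ G := by
    intro s hs hgap
    rw [hG]
    refine Real.le_sqrt_of_sq_le ((norm_sq_le_of_noise hB (hgrad_sq s) (hnoise s hs)).trans ?_)
    gcongr
  have hNt : ∀ t ≤ T, ∑ s ∈ range t, ‖adaGradDir ε (g (s + 1)) (v (s + 1))‖ ^ 2 ≤ N :=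
    fun t ht => (sum_le_sum_of_subset_of_nonneg (range_mono ht) fun _ _ _ => sq_nonneg _).trans hN
  have hstep : ∀ t ≤ T, (∀ s < t, f (x (s + 1)) - c ≤ Δ) → f (x (t + 1)) - c ≤ Δ ∧
      η / (1 - β) * ∑ s ∈ range t,
        inner ℝ (f' (x (s + 1))) (surrogateDir G ε (v s) (f' (x (s + 1)))) ≤ Δ :=
    fun t ht hgap => h.gap_le_and_sum_le hβ0 hβ1 hη hε hgrad hsmooth hL hc hG0
      (fun s hs => hgG s (hs.trans_le ht) (hgap s hs)) (hNt t ht) (hgood t ht hgap) hΔ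
  have hgap : ∀ t ≤ T, f (x (t + 1)) - c ≤ Δ := by
    intro t
    induction t using Nat.strong_induction_on with
    | _ t ih => exact fun ht => (hstep t ht fun s hs => ih s hs (hs.le.trans ht)).1
  have hQ := (hstep T le_rfl fun s hs => hgap s hs.le).2
  rw [div_mul_eq_mul_div, div_le_iff₀ hβ, mul_comm, ← le_div_iff₀ hη] at hQ
  refine sum_sq_le_of_self_bound (W := ∑ s ∈ range T, ‖g (s + 1)‖ ^ 2)
    (sum_nonneg fun _ _ => sq_nonneg _) (by positivity) (by positivity) (by positivity) ?_ ?_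
  · refine le_trans ?_ (mul_le_mul_of_nonneg_left hQ (by positivity))
    rw [mul_sum]
    exact sum_le_sum fun s hs => norm_sq_le_mul_inner_surrogateDir hG0 hε (h.v_nonneg s)
      (h.v_le_sum_norm_sq (mem_range.1 hs).le) _
  · have h1 : ∀ s ∈ range T, ‖g (s + 1)‖ ^ 2 ≤
        2 * (B + 1) * ‖f' (x (s + 1))‖ ^ 2 + 2 * (A * Δ + C) := by
      intro s hs
      have h2 : ‖g (s + 1)‖ ≤ ‖g (s + 1) - f' (x (s + 1))‖ + ‖f' (x (s + 1))‖ := by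
        simpa using norm_add_le (g (s + 1) - f' (x (s + 1))) (f' (x (s + 1)))
      have h3 := mul_le_mul_of_nonneg_left (hgap s (mem_range.1 hs).le) hA.le
      nlinarith [hnoise s (mem_range.1 hs), norm_nonneg (g (s + 1)),
        sq_nonneg (‖g (s + 1) - f' (x (s + 1))‖ - ‖f' (x (s + 1))‖)]
    refine (sum_le_sum h1).trans_eq ?_
    rw [sum_add_distrib, ← mul_sum, sum_const, card_range, nsmul_eq_mul]
    ring

end IsAdaGradRun

end Run

section Concentration

/-- The exponential inequality behind the concentration bound. -/
theorem exp_sub_le_one_add_mul_exp_neg {z u : ℝ} (hz : |z| ≤ 1) (hu : 3 / 4 * z ^ 2 ≤ u) :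
    exp (z - u) ≤ 1 + exp (-u) * z := by
  have h1 : exp z ≤ 1 + z + 3 / 4 * z ^ 2 := by
    have h := (abs_le.1 (Real.exp_bound hz (n := 2) (by norm_num))).2
    norm_num [sum_range_succ, Nat.factorial] at h
    linarith
  have h2 : (1 + u) * exp (-u) ≤ 1 := by
    have h3 := Real.add_one_le_exp u
    calc (1 + u) * exp (-u) ≤ exp u * exp (-u) := by gcongr; linarith
      _ = 1 := by rw [← Real.exp_add]; simp
  have h4 : exp z * exp (-u) ≤ (1 + z + u) * exp (-u) := by gcongr; linarith
  rw [sub_eq_add_neg, Real.exp_add]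
  linarith

variable {Ω : Type*} {m0 : MeasurableSpace Ω} {μ : Measure Ω} [IsProbabilityMeasure μ]
  {F : Filtration ℕ m0} {z u : ℕ → Ω → ℝ} {T : ℕ}

/-- The compensated exponential of a bounded martingale difference sequence has mean at most
one. -/
theorem integral_exp_sum_sub_le_one (hz : ∀ s < T, StronglyMeasurable[F (s + 1)] (z s))
    (hu : ∀ s < T, StronglyMeasurable[F s] (u s))
    (hzu : ∀ s < T, ∀ᵐ ω ∂μ, |z s ω| ≤ 1 ∧ 3 / 4 * z s ω ^ 2 ≤ u s ω)
    (hmart : ∀ s < T, μ[z s | F s] =ᵐ[μ] 0) {t : ℕ} (ht : t ≤ T) :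
    StronglyMeasurable[F t] (fun ω => exp (∑ s ∈ range t, (z s ω - u s ω))) ∧
      (∀ᵐ ω ∂μ, exp (∑ s ∈ range t, (z s ω - u s ω)) ≤ exp t) ∧
      ∫ ω, exp (∑ s ∈ range t, (z s ω - u s ω)) ∂μ ≤ 1 := by
  induction t with
  | zero => simpa using stronglyMeasurable_const
  | succ t ih =>
    obtain ⟨hmeas, hbound, hint⟩ := ih (by omega)
    have htT : t < T := by omega
    have hexp : ∀ ω, exp (∑ s ∈ range (t + 1), (z s ω - u s ω)) =
        exp (∑ s ∈ range t, (z s ω - u s ω)) * exp (z t ω - u t ω) := fun ω => by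
      rw [sum_range_succ, Real.exp_add]
    simp only [hexp]
    set W : Ω → ℝ := fun ω => exp (∑ s ∈ range t, (z s ω - u s ω)) with hW
    have hW0 : ∀ ω, 0 ≤ W ω := fun ω => (Real.exp_pos _).le
    have hmeas' : StronglyMeasurable[F (t + 1)] (fun ω => W ω * exp (z t ω - u t ω)) :=
      (hmeas.mono (F.mono t.le_succ)).mul (Real.continuous_exp.comp_stronglyMeasurable
        ((hz t htT).sub ((hu t htT).mono (F.mono t.le_succ))))
    have hbound' : ∀ᵐ ω ∂μ, W ω * exp (z t ω - u t ω) ≤ exp ((t + 1 : ℕ) : ℝ) := by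
      filter_upwards [hbound, hzu t htT] with ω h1 h2
      rw [Nat.cast_succ, Real.exp_add]
      have : z t ω - u t ω ≤ 1 := by
        nlinarith [(abs_le.1 h2.1).2, sq_nonneg (z t ω)]
      gcongr
    refine ⟨hmeas', hbound', ?_⟩
    set w : Ω → ℝ := fun ω => W ω * exp (-u t ω) with hw
    have hw_meas : StronglyMeasurable[F t] w :=
      hmeas.mul (Real.continuous_exp.comp_stronglyMeasurable (hu t htT).neg)
    have hw_bound : ∀ᵐ ω ∂μ, ‖w ω‖ ≤ exp t := by
      filter_upwards [hbound, hzu t htT] with ω h1 h2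
      have h3 : exp (-u t ω) ≤ 1 := Real.exp_le_one_iff.2 (by nlinarith [sq_nonneg (z t ω)])
      rw [Real.norm_of_nonneg (mul_nonneg (hW0 ω) (Real.exp_pos _).le)]
      exact (mul_le_of_le_one_right (hW0 ω) h3).trans h1
    have hz_int : Integrable (z t) μ :=
      .of_bound ((hz t htT).mono (F.le _)).aestronglyMeasurable 1
        ((hzu t htT).mono fun ω h => h.1)
    have hwz_int : Integrable (fun ω => w ω * z t ω) μ :=
      hz_int.bdd_mul (hw_meas.mono (F.le _)).aestronglyMeasurable hw_bound
    have hwz : ∫ ω, w ω * z t ω ∂μ = 0 := by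
      have h1 : μ[fun ω => w ω * z t ω | F t] =ᵐ[μ] 0 := by
        filter_upwards [condExp_stronglyMeasurable_mul_of_bound (F.le t) hw_meas hz_int _ hw_bound,
          hmart t htT] with ω h1 h2
        have h3 : (μ[w * z t | F t]) ω = 0 := by simp [h1, h2]
        exact h3
      rw [← integral_condExp (F.le t), integral_congr_ae h1]
      simp
    have hW_int : Integrable W μ :=
      .of_bound (hmeas.mono (F.le _)).aestronglyMeasurable (exp t) (by
        filter_upwards [hbound] with ω h
        rwa [Real.norm_of_nonneg (hW0 ω)])
    have hW_int' : Integrable (fun ω => W ω * exp (z t ω - u t ω)) μ :=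
      .of_bound (hmeas'.mono (F.le _)).aestronglyMeasurable (exp ((t + 1 : ℕ) : ℝ)) (by
        filter_upwards [hbound'] with ω h
        rwa [Real.norm_of_nonneg (mul_nonneg (hW0 ω) (Real.exp_pos _).le)])
    calc ∫ ω, W ω * exp (z t ω - u t ω) ∂μ ≤ ∫ ω, (W ω + w ω * z t ω) ∂μ := by
          refine integral_mono_ae hW_int' (hW_int.add hwz_int) ?_
          filter_upwards [hzu t htT] with ω h
          have := mul_le_mul_of_nonneg_left (exp_sub_le_one_add_mul_exp_neg h.1 h.2) (hW0 ω)
          simp only [hw]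
          linarith
      _ ≤ 1 := by
          rw [integral_add hW_int hwz_int, hwz, add_zero]
          exact hint

/-- Uniform-in-time concentration of a compensated bounded martingale. -/
theorem measure_exists_log_lt_sum_le (hz : ∀ s < T, StronglyMeasurable[F (s + 1)] (z s))
    (hu : ∀ s < T, StronglyMeasurable[F s] (u s))
    (hzu : ∀ s < T, ∀ᵐ ω ∂μ, |z s ω| ≤ 1 ∧ 3 / 4 * z s ω ^ 2 ≤ u s ω)
    (hmart : ∀ s < T, μ[z s | F s] =ᵐ[μ] 0) (hT : 1 ≤ T) {δ : ℝ} (hδ0 : 0 < δ) (hδ1 : δ < 1) :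
    μ {ω | ∃ t ≤ T, log (T / δ) < ∑ s ∈ range t, (z s ω - u s ω)} ≤ ENNReal.ofReal δ := by
  have hT0 : (0 : ℝ) < T := by exact_mod_cast hT
  have hTδ : 0 < (T : ℝ) / δ := by positivity
  have hlog : 0 ≤ log (T / δ) := by
    refine Real.log_nonneg ((one_le_div hδ0).2 (hδ1.le.trans ?_))
    exact_mod_cast hT
  have hsub : {ω | ∃ t ≤ T, log (T / δ) < ∑ s ∈ range t, (z s ω - u s ω)} ⊆
      ⋃ t ∈ Icc 1 T, {ω | T / δ ≤ exp (∑ s ∈ range t, (z s ω - u s ω))} := by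
    rintro ω ⟨t, ht, hlt⟩
    simp only [Set.mem_iUnion, Set.mem_ofPred_eq, mem_Icc]
    refine ⟨t, ⟨?_, ht⟩, (Real.le_exp_log _).trans (Real.exp_le_exp.2 hlt.le)⟩
    rcases Nat.eq_zero_or_pos t with rfl | h
    · simp only [range_zero, sum_empty] at hlt
      linarith
    · exact h
  have hone : ∀ t ∈ Icc 1 T,
      μ.real {ω | T / δ ≤ exp (∑ s ∈ range t, (z s ω - u s ω))} ≤ δ / T := by
    intro t ht
    obtain ⟨h1, h2, h3⟩ := integral_exp_sum_sub_le_one hz hu hzu hmart (mem_Icc.1 ht).2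
    have hint : Integrable (fun ω => exp (∑ s ∈ range t, (z s ω - u s ω))) μ :=
      .of_bound (h1.mono (F.le _)).aestronglyMeasurable (exp t) (by
        filter_upwards [h2] with ω h
        rwa [Real.norm_of_nonneg (Real.exp_pos _).le])
    have h4 := (mul_meas_ge_le_integral_of_nonneg
      (.of_forall fun ω => (Real.exp_pos _).le) hint (T / δ)).trans h3
    rwa [← le_div_iff₀' hTδ, one_div_div] at h4
  rw [← ENNReal.ofReal_toReal (measure_ne_top μ _)]
  refine ENNReal.ofReal_le_ofReal ?_
  calc _ ≤ μ.real (⋃ t ∈ Icc 1 T, {ω | T / δ ≤ exp (∑ s ∈ range t, (z s ω - u s ω))}) :=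
        measureReal_mono hsub (measure_ne_top _ _)
    _ ≤ ∑ t ∈ Icc 1 T, μ.real {ω | T / δ ≤ exp (∑ s ∈ range t, (z s ω - u s ω))} :=
        measureReal_biUnion_finset_le _ _
    _ ≤ ∑ _t ∈ Icc 1 T, δ / T := sum_le_sum hone
    _ = δ := by
        rw [sum_const, Nat.card_Icc, nsmul_eq_mul, Nat.add_sub_cancel]
        field_simp

/-- Noise paired with a bounded predictable vector has zero conditional mean. -/
theorem condExp_inner_sub_eq_zero {E : Type*} [NormedAddCommGroup E] [InnerProductSpace ℝ E]
    [CompleteSpace E] {m : MeasurableSpace Ω} (hm : m ≤ m0) {P g h : Ω → E}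
    (hP : StronglyMeasurable[m] P) {K : ℝ} (hPK : ∀ ω, ‖P ω‖ ≤ K) (hg : Integrable g μ)
    (hh : StronglyMeasurable[m] h) (hgh : μ[g | m] =ᵐ[μ] h) :
    μ[fun ω => inner ℝ (P ω) (g ω - h ω) | m] =ᵐ[μ] 0 := by
  have hh_int : Integrable h μ := integrable_condExp.congr hgh
  filter_upwards [condExp_stronglyMeasurable_bilin_of_bound (innerSL ℝ) hm hP (hg.sub hh_int) K
    (.of_forall hPK), condExp_sub hg hh_int m, hgh] with ω h1 h2 h3
  rw [condExp_of_stronglyMeasurable hm hh hh_int] at h2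
  have h4 : (μ[g - h | m]) ω = 0 := by rw [h2, Pi.sub_apply, h3, sub_self]
  rw [h4, map_zero] at h1
  exact h1

end Concentration

section Measurability

variable {Ω : Type*} {d : ℕ} {mΩ : MeasurableSpace Ω}

theorem measurable_euclidean_of_coord {h : Ω → EuclideanSpace ℝ (Fin d)}
    (hh : ∀ i, Measurable fun ω => h ω i) : Measurable h :=
  (PiLp.continuous_toLp 2 fun _ : Fin d => ℝ).measurable.comp (measurable_pi_lambda _ hh)

theorem measurable_euclidean_coord {h : Ω → EuclideanSpace ℝ (Fin d)} (hh : Measurable h)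
    (i : Fin d) : Measurable fun ω => h ω i :=
  (EuclideanSpace.proj (𝕜 := ℝ) i).continuous.measurable.comp hh

theorem measurable_surrogateDir {G ε : ℝ} {v h : Ω → EuclideanSpace ℝ (Fin d)}
    (hv : Measurable v) (hh : Measurable h) :
    Measurable fun ω => surrogateDir G ε (v ω) (h ω) :=
  measurable_euclidean_of_coord fun i => (measurable_euclidean_coord hh i).div
    ((((measurable_euclidean_coord hv i).add_const _).sqrt).add_const _)

/-- The iterates are measurable functions of the past stochastic gradients. -/
theorem measurable_adaGrad_iterates {β η ε : ℝ} {g v m x : ℕ → Ω → EuclideanSpace ℝ (Fin d)}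
    (hrun : ∀ ω, IsAdaGradRun β η ε (g · ω) (v · ω) (m · ω) (x · ω))
    {x1 : EuclideanSpace ℝ (Fin d)} (hx1 : ∀ ω, x 1 ω = x1) (s : ℕ)
    (hg : ∀ j < s, Measurable (g (j + 1))) :
    Measurable (v s) ∧ Measurable (m s) ∧ Measurable (x (s + 1)) := by
  induction s with
  | zero =>
    refine ⟨?_, ?_, ?_⟩
    · rw [show v 0 = fun _ => 0 from funext fun ω => (hrun ω).v_zero]
      exact measurable_const
    · rw [show m 0 = fun _ => 0 from funext fun ω => (hrun ω).m_zero]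
      exact measurable_const
    · rw [show x (0 + 1) = fun _ => x1 from funext hx1]
      exact measurable_const
  | succ s ih =>
    obtain ⟨hv, hm, hx⟩ := ih fun j hj => hg j (by omega)
    have hgs := hg s s.lt_succ_self
    have hv' : Measurable (v (s + 1)) := by
      refine measurable_euclidean_of_coord fun i => ?_
      simp_rw [fun ω => (hrun ω).v_succ s i]
      exact (measurable_euclidean_coord hv i).add ((measurable_euclidean_coord hgs i).pow_const 2)
    have hm' : Measurable (m (s + 1)) := by
      refine measurable_euclidean_of_coord fun i => ?_
      simp_rw [fun ω => (hrun ω).m_succ s i]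
      exact ((measurable_euclidean_coord hm i).const_mul β).sub
        (((measurable_euclidean_coord hgs i).const_mul η).div
          ((measurable_euclidean_coord hv' i).sqrt.add_const ε))
    refine ⟨hv', hm', ?_⟩
    rw [show x (s + 1 + 1) = x (s + 1) + m (s + 1) from funext fun ω => (hrun ω).x_succ s]
    exact hx.add hm'

end Measurability

section Noise

variable {d : ℕ} {G ε : ℝ} {v h : EuclideanSpace ℝ (Fin d)}

theorem norm_surrogateDir_sq_le (hε : 0 < ε) (hv : ∀ i, 0 ≤ v i) :
    G * ‖surrogateDir G ε v h‖ ^ 2 ≤ inner ℝ h (surrogateDir G ε v h) := by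
  rw [euclidean_inner_eq_sum, EuclideanSpace.real_norm_sq_eq, mul_sum]
  refine sum_le_sum fun i _ => ?_
  have h1 : G ≤ √(v i + G ^ 2) := Real.le_sqrt_of_sq_le (by linarith [hv i])
  have hpos : 0 < √(v i + G ^ 2) + ε := by positivity
  have e : h i * surrogateDir G ε v h i =
      (√(v i + G ^ 2) + ε) * surrogateDir G ε v h i ^ 2 := by
    rw [surrogateDir]
    field_simp
  rw [e]
  gcongr
  linarith

theorem norm_surrogateDir_le_one (hG : 0 < G) (hε : 0 < ε) (hv : ∀ i, 0 ≤ v i) (hh : ‖h‖ ≤ G) :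
    ‖surrogateDir G ε v h‖ ≤ 1 := by
  have h1 := norm_surrogateDir_sq_le (G := G) (h := h) hε hv
  have h2 := real_inner_le_norm h (surrogateDir G ε v h)
  by_contra! hlt
  nlinarith [mul_le_mul_of_nonneg_right hh (norm_nonneg (surrogateDir G ε v h)),
    mul_lt_mul_of_pos_left hlt (mul_pos hG (zero_lt_one.trans hlt))]

/-- Size and variance proxy of a normalized noise term. -/
theorem noise_bounds {w : EuclideanSpace ℝ (Fin d)} (hG : 0 < G) (hε : 0 < ε)
    (hv : ∀ i, 0 ≤ v i) (hh : ‖h‖ ≤ G) (hw : ‖w‖ ≤ G) :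
    |inner ℝ (-(1 / (3 * G)) • surrogateDir G ε v h) w| ≤ 1 ∧
      3 / 4 * (inner ℝ (-(1 / (3 * G)) • surrogateDir G ε v h) w) ^ 2 ≤
        1 / (12 * G) * inner ℝ h (surrogateDir G ε v h) := by
  have h1 := norm_surrogateDir_sq_le (G := G) (h := h) hε hv
  have h2 := norm_surrogateDir_le_one hG hε hv hh
  have h3 : |inner ℝ (surrogateDir G ε v h) w| ≤ ‖surrogateDir G ε v h‖ * G :=
    (abs_real_inner_le_norm _ _).trans (by gcongr)
  rw [real_inner_smul_left]
  set r := inner ℝ (surrogateDir G ε v h) w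
  set n := ‖surrogateDir G ε v h‖
  constructor
  · rw [abs_mul, abs_neg, abs_of_pos (by positivity : 0 < 1 / (3 * G))]
    calc 1 / (3 * G) * |r| ≤ 1 / (3 * G) * (1 * G) := by gcongr; exact h3.trans (by gcongr)
      _ ≤ 1 := by field_simp; norm_num
  · have h4 : r ^ 2 ≤ (n * G) ^ 2 := by
      rw [← sq_abs]
      gcongr
    calc 3 / 4 * (-(1 / (3 * G)) * r) ^ 2 = 1 / (12 * G ^ 2) * r ^ 2 := by
          field_simp
          ring
      _ ≤ 1 / (12 * G ^ 2) * (n * G) ^ 2 := by gcongr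
      _ = 1 / (12 * G) * (G * n ^ 2) := by field_simp
      _ ≤ _ := by gcongr

end Noise

theorem sum_Icc_one_eq_sum_range (T : ℕ) (a : ℕ → ℝ) :
    ∑ s ∈ Icc 1 T, a s = ∑ s ∈ range T, a (s + 1) := by
  rw [range_eq_Ico, sum_Ico_add' a 0 T 1]
  rfl

theorem stmt_0
    {Ω : Type*} {m0 : MeasurableSpace Ω} {μ : Measure Ω} [IsProbabilityMeasure μ]
    (F : Filtration ℕ m0)
    {d : ℕ} (β η ε : ℝ) (hβ0 : 0 ≤ β) (hβ1 : β < 1) (hη : 0 < η) (hε : 0 < ε)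
    (T : ℕ) (hT : 1 ≤ T) (δ : ℝ) (hδ0 : 0 < δ) (hδ1 : δ < 1)
    (g v m x : ℕ → Ω → EuclideanSpace ℝ (Fin d))
    (x1 : EuclideanSpace ℝ (Fin d)) (hx1 : ∀ ω, x 1 ω = x1)
    (hv0 : ∀ ω, v 0 ω = 0) (hm0 : ∀ ω, m 0 ω = 0) (hx0 : ∀ ω, x 0 ω = x 1 ω)
    (hv : ∀ s, 1 ≤ s → ∀ ω i, v s ω i = v (s - 1) ω i + g s ω i ^ 2)
    (hmrec : ∀ s, 1 ≤ s → ∀ ω i,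
      m s ω i = β * m (s - 1) ω i - η * g s ω i / (Real.sqrt (v s ω i) + ε))
    (hxrec : ∀ s, 1 ≤ s → ∀ ω, x (s + 1) ω = x s ω + m s ω)
    (f : EuclideanSpace ℝ (Fin d) → ℝ) (fgrad : EuclideanSpace ℝ (Fin d) → EuclideanSpace ℝ (Fin d))
    (hgrad : ∀ p, HasGradientAt f (fgrad p) p)
    (L : ℝ) (hL : 0 < L)
    (hsmooth : ∀ p q, ‖fgrad p - fgrad q‖ ≤ L * ‖p - q‖)
    (fstar : ℝ) (hfstar : ∀ p, fstar ≤ f p)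
    (A B C : ℝ) (hA : 0 < A) (hB : 0 < B) (hC : 0 < C)
    (hmeas : ∀ s, 1 ≤ s → s ≤ T → Measurable[F s] (g s))
    (hA2 : ∀ s, 1 ≤ s → s ≤ T → μ[g s | F (s - 1)] =ᵐ[μ] fun ω => fgrad (x s ω))
    (hA3 : ∀ s, 1 ≤ s → s ≤ T → ∀ᵐ ω ∂μ,
      ‖g s ω - fgrad (x s ω)‖ ^ 2 ≤
        A * (f (x s ω) - fstar) + B * ‖fgrad (x s ω)‖ ^ 2 + C)
    (X Ltil FT Δ G Δ₁ B₁ : ℝ)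
    (hX : X = 2 * A + 4 * L * B + 4 * L)
    (hLtil : Ltil = L * η ^ 2 / (2 * (1 - β) ^ 3) + L * η ^ 2 / (2 * (1 - β) ^ 2))
    (hFT : FT = 1 + 1 / ε ^ 2 *
      ((X * (f x1 - fstar) + 2 * C) * (T : ℝ) +
        (η * ‖fgrad x1‖ * Real.sqrt (d : ℝ) / (1 - β) +
          L * η ^ 2 * (d : ℝ) / (2 * (1 - β) ^ 2)) * X * (T : ℝ) ^ 2 +
        L * η ^ 2 * (d : ℝ) * X * (T : ℝ) ^ 3 / (1 - β) ^ 2))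
    (hΔ : Δ = 4 * (f x1 - fstar) +
      12 * Real.sqrt (2 * C) * η / (1 - β) * Real.log ((T : ℝ) / δ) +
      4 * (Real.sqrt (2 * C) * η / (1 - β) + L * η ^ 2 / (1 - β) ^ 3 + Ltil) * (d : ℝ) *
        Real.log FT +
      72 * X * η ^ 2 / (1 - β) ^ 2 * Real.log ((T : ℝ) / δ) ^ 2 +
      8 * X * η ^ 2 / (1 - β) ^ 2 * (d : ℝ) ^ 2 * Real.log FT ^ 2)
    (hG : G = Real.sqrt (X * Δ + 2 * C))
    (hΔ₁ : Δ₁ = Δ * (1 - β) / η)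
    (hB₁ : B₁ = B + 1)
 :
    ENNReal.ofReal (1 - δ) ≤
      μ {ω | 1 / (T : ℝ) * ∑ s ∈ Finset.Icc 1 T, ‖fgrad (x s ω)‖ ^ 2 ≤
        2 * Δ₁ * ((B₁ * Δ₁ + G + ε) / (T : ℝ) +
          Real.sqrt (2 * (A * Δ + C) / (T : ℝ)))} := by
  have hβ : 0 < 1 - β := sub_pos.2 hβ1
  have hT0 : (0 : ℝ) < T := by exact_mod_cast hT
  have hrun : ∀ ω, IsAdaGradRun β η ε (g · ω) (v · ω) (m · ω) (x · ω) := fun ω =>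
    { v_zero := hv0 ω
      m_zero := hm0 ω
      v_succ := fun s i => hv (s + 1) s.succ_pos ω i
      m_succ := fun s i => hmrec (s + 1) s.succ_pos ω i
      x_succ := fun s => hxrec (s + 1) s.succ_pos ω }
  have hΔ₀ : 0 ≤ f x1 - fstar := sub_nonneg.2 (hfstar x1)
  have hX0 : 0 ≤ X := by rw [hX]; positivity
  have hFT1 : 1 ≤ FT := by
    rw [hFT, le_add_iff_nonneg_right]
    positivity
  have hlFT : 0 ≤ log FT := Real.log_nonneg hFT1
  have hℓ : 0 ≤ log (T / δ) :=
    Real.log_nonneg ((one_le_div hδ0).2 (hδ1.le.trans (by exact_mod_cast hT)))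
  have hΔ0 : 0 ≤ Δ := by rw [hΔ, hLtil]; positivity
  have hG0 : 0 < G := hG ▸ Real.sqrt_pos.2 (by positivity)
  have hGsq : G ^ 2 = X * Δ + 2 * C := by rw [hG, Real.sq_sqrt (by positivity)]
  have hbound := adaGrad_bound_le (N := d * log FT) hβ0 hβ1 hη hL hX0 hC hΔ₀ hℓ d.cast_nonneg hlFT
    rfl (hLtil ▸ hΔ) hG
  have hgrad_sq := norm_gradient_sq_le hgrad hsmooth hL hfstar
  have hf_cont : Continuous f :=
    continuous_iff_continuousAt.2 fun p => (hgrad p).hasFDerivAt.continuousAt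
  have hf'_cont : Continuous fgrad :=
    (LipschitzWith.of_dist_le_mul (K := ⟨L, hL.le⟩) fun p q => by
      rw [dist_eq_norm, dist_eq_norm]
      exact hsmooth p q).continuous
  have hnoise : ∀ᵐ ω ∂μ, ∀ s < T, ‖g (s + 1) ω - fgrad (x (s + 1) ω)‖ ^ 2 ≤
      A * (f (x (s + 1) ω) - fstar) + B * ‖fgrad (x (s + 1) ω)‖ ^ 2 + C := by
    refine ae_all_iff.2 fun s => ?_
    by_cases hs : s < T
    · filter_upwards [hA3 (s + 1) s.succ_pos hs] with ω h _ using h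
    · exact .of_forall fun ω h => absurd h hs
  have hgX : ∀ᵐ ω ∂μ, ∀ s < T, ‖g (s + 1) ω‖ ^ 2 ≤ X * (f (x (s + 1) ω) - fstar) + 2 * C := by
    filter_upwards [hnoise] with ω h s hs
    rw [hX]
    exact norm_sq_le_of_noise hB (hgrad_sq _) (h s hs)
  have hg_meas : ∀ s < T, Measurable[F (s + 1)] (g (s + 1)) :=
    fun s hs => hmeas (s + 1) s.succ_pos hs
  have hiter : ∀ s ≤ T, Measurable[F s] (v s) ∧ Measurable[F s] (m s) ∧
      Measurable[F s] (x (s + 1)) := fun s hs =>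
    measurable_adaGrad_iterates hrun hx1 s fun j hj =>
      (hg_meas j (hj.trans_le hs)).mono (F.mono hj) le_rfl
  have hg_int : ∀ s < T, Integrable (g (s + 1)) μ := by
    intro s hs
    refine .of_bound ((hg_meas s hs).mono (F.le _) le_rfl).aestronglyMeasurable
      (√(X * (f x1 - fstar + η * ‖fgrad x1‖ * √d / (1 - β) * T +
        L * η ^ 2 * d / (2 * (1 - β) ^ 2) * T ^ 2) + 2 * C)) ?_
    filter_upwards [hgX] with ω h
    refine Real.le_sqrt_of_sq_le ((h s hs).trans ?_)
    have := (hrun ω).gap_le_growth (c := fstar) hβ0 hβ1 hη hε hgrad hsmooth hL hs.le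
    rw [hx1 ω] at this
    gcongr
  let E : ℕ → Set Ω := fun s => {ω | ∀ j ≤ s, f (x (j + 1) ω) - fstar ≤ Δ}
  have hE : ∀ s < T, MeasurableSet[F s] (E s) := by
    intro s hs
    have : E s = ⋂ j ∈ Set.Iic s, {ω | f (x (j + 1) ω) - fstar ≤ Δ} := by
      ext ω
      simp [E]
    rw [this]
    refine MeasurableSet.biInter (Set.to_countable _) fun j hj => ?_
    have hxj : Measurable[F s] (x (j + 1)) :=
      (hiter j (le_trans hj hs.le)).2.2.mono (F.mono hj) le_rfl
    exact measurableSet_le ((hf_cont.measurable.comp hxj).sub_const _) measurable_const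
  let P : ℕ → Ω → EuclideanSpace ℝ (Fin d) := fun s => (E s).indicator fun ω =>
    -(1 / (3 * G)) • surrogateDir G ε (v s ω) (fgrad (x (s + 1) ω))
  let z : ℕ → Ω → ℝ := fun s ω => inner ℝ (P s ω) (g (s + 1) ω - fgrad (x (s + 1) ω))
  let u : ℕ → Ω → ℝ := fun s => (E s).indicator fun ω => 1 / (12 * G) *
    inner ℝ (fgrad (x (s + 1) ω)) (surrogateDir G ε (v s ω) (fgrad (x (s + 1) ω)))
  have hgradG : ∀ s, ∀ ω ∈ E s, ‖fgrad (x (s + 1) ω)‖ ≤ G := by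
    intro s ω hω
    refine le_of_sq_le_sq ?_ hG0.le
    rw [hGsq, hX]
    have h1 := hgrad_sq (x (s + 1) ω)
    have h2 := mul_le_mul_of_nonneg_left (hω s le_rfl) hL.le
    have h3 : 0 ≤ (2 * A + 4 * L * B + 2 * L) * Δ := by positivity
    linarith
  have hh_meas : ∀ s < T, Measurable[F s] fun ω => fgrad (x (s + 1) ω) := fun s hs =>
    hf'_cont.measurable.comp (hiter s hs.le).2.2
  have hdir_meas : ∀ s < T, Measurable[F s] fun ω =>
      surrogateDir G ε (v s ω) (fgrad (x (s + 1) ω)) := fun s hs =>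
    measurable_surrogateDir (hiter s hs.le).1 (hh_meas s hs)
  have hP_meas : ∀ s < T, StronglyMeasurable[F s] (P s) := fun s hs =>
    ((hdir_meas s hs).stronglyMeasurable.const_smul (-(1 / (3 * G)))).indicator (hE s hs)
  have hP_bound : ∀ s ω, ‖P s ω‖ ≤ 1 / (3 * G) := by
    intro s ω
    by_cases hω : ω ∈ E s
    · simp only [P, Set.indicator_of_mem hω]
      rw [norm_smul, norm_neg, Real.norm_of_nonneg (by positivity)]
      exact mul_le_of_le_one_right (by positivity)
        (norm_surrogateDir_le_one hG0 hε ((hrun ω).v_nonneg s) (hgradG s ω hω))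
    · simp only [P, Set.indicator_of_notMem hω, norm_zero]
      positivity
  have hz_meas : ∀ s < T, StronglyMeasurable[F (s + 1)] (z s) := fun s hs =>
    ((hP_meas s hs).mono (F.mono s.le_succ)).inner ((hg_meas s hs).stronglyMeasurable.sub
      ((hh_meas s hs).stronglyMeasurable.mono (F.mono s.le_succ)))
  have hu_meas : ∀ s < T, StronglyMeasurable[F s] (u s) := fun s hs =>
    (((hh_meas s hs).stronglyMeasurable.inner
      (hdir_meas s hs).stronglyMeasurable).const_mul _).indicator (hE s hs)
  have hzu : ∀ s < T, ∀ᵐ ω ∂μ, |z s ω| ≤ 1 ∧ 3 / 4 * z s ω ^ 2 ≤ u s ω := by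
    intro s hs
    filter_upwards [hnoise] with ω h
    by_cases hω : ω ∈ E s
    · simp only [z, u, P, Set.indicator_of_mem hω]
      refine noise_bounds hG0 hε ((hrun ω).v_nonneg s) (hgradG s ω hω) ?_
      refine le_of_sq_le_sq ((h s hs).trans ?_) hG0.le
      rw [hGsq, hX]
      have h1 := mul_le_mul_of_nonneg_left (hgrad_sq (x (s + 1) ω)) hB.le
      have h2 := mul_le_mul_of_nonneg_left (hω s le_rfl) (by positivity : 0 ≤ A + 2 * L * B)
      have h3 : 0 ≤ (A + 2 * L * B + 4 * L) * Δ := by positivity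
      linarith
    · simp [z, u, P, Set.indicator_of_notMem hω]
  have hmart : ∀ s < T, μ[z s | F s] =ᵐ[μ] 0 := fun s hs =>
    condExp_inner_sub_eq_zero (F.le s) (hP_meas s hs) (hP_bound s) (hg_int s hs)
      (hh_meas s hs).stronglyMeasurable (hA2 (s + 1) s.succ_pos hs)
  have hbad := measure_exists_log_lt_sum_le hz_meas hu_meas hzu hmart hT hδ0 hδ1
  set bad := {ω | ∃ t ≤ T, log (T / δ) < ∑ s ∈ range t, (z s ω - u s ω)} with hbad_def
  have hgood : ENNReal.ofReal (1 - δ) ≤ μ badᶜ := by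
    have h1 : (1 : ENNReal) ≤ μ bad + μ badᶜ := by
      rw [← measure_univ (μ := μ)]
      exact measure_univ_le_add_compl bad
    rw [ENNReal.ofReal_sub _ hδ0.le, ENNReal.ofReal_one, tsub_le_iff_left]
    exact h1.trans (by gcongr)
  refine hgood.trans (measure_mono_ae ?_)
  filter_upwards [hnoise, hgX] with ω hω_noise hω_gX hω
  have hω_le : ∀ t ≤ T, ∑ s ∈ range t, (z s ω - u s ω) ≤ log (T / δ) := by
    intro t ht
    by_contra! hlt
    exact hω ⟨t, ht, hlt⟩
  have hN : ∑ s ∈ range T, ‖adaGradDir ε (g (s + 1) ω) (v (s + 1) ω)‖ ^ 2 ≤ d * log FT := by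
    refine ((hrun ω).sum_norm_dir_sq_le hε T).trans ?_
    have hgrowth := (hrun ω).norm_sum_sq_growth hβ0 hβ1 hη hε hgrad hsmooth hL hX0 hω_gX
    rw [hx1 ω] at hgrowth
    rw [hFT]
    gcongr
  have hsum := (hrun ω).sum_norm_gradient_sq_le (ℓ := log (T / δ)) hβ0 hβ1 hη hε hgrad hsmooth hL
    hfstar hA hB hC hΔ0 (hX ▸ hG) hω_noise hN (fun t ht hgap => by
      have hterm : ∀ s ∈ range t, z s ω - u s ω = 1 / (3 * G) *
          (-inner ℝ (surrogateDir G ε (v s ω) (fgrad (x (s + 1) ω)))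
            (g (s + 1) ω - fgrad (x (s + 1) ω)) -
          1 / 4 * inner ℝ (fgrad (x (s + 1) ω))
            (surrogateDir G ε (v s ω) (fgrad (x (s + 1) ω)))) := by
        intro s hs
        have hωE : ω ∈ E s := fun j hj => hgap j (hj.trans_lt (mem_range.1 hs))
        simp only [z, u, P, Set.indicator_of_mem hωE, real_inner_smul_left]
        field_simp
        ring
      have h1 := hω_le t ht
      rwa [sum_congr rfl hterm, ← mul_sum, one_div, inv_mul_le_iff₀ (by positivity)] at h1)
    (by rw [hx1 ω]; exact hbound)
  rw [← hΔ₁, ← hB₁] at hsum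
  change 1 / (T : ℝ) * ∑ s ∈ Icc 1 T, ‖fgrad (x s ω)‖ ^ 2 ≤ _
  have hsqrt : √(2 * (A * Δ + C) / T) = √(2 * (A * Δ + C) * T) / T := by
    rw [← Real.sqrt_sq hT0.le, ← Real.sqrt_div (by positivity), Real.sqrt_sq hT0.le]
    congr 1
    field_simp
  rw [sum_Icc_one_eq_sum_range, hsqrt, one_div, inv_mul_le_iff₀ hT0]
  refine hsum.trans_eq ?_
  field_simp
  ring
end

section
/- Given T ≥ 1 and δ ∈ (0,1), in the stochastic AdaGrad-with-momentum setting with assumptions (A2) and (A3), with probability at least 1 − δ the following holds for all t ∈ {1, …, T}: −Σ_{s=1}^t Σ_{i=1}^d ḡ_{s,i}·ξ_{s,i}/a_{s,i} ≤ (1/4)·Σ_{s=1}^t (G_s/G)·Σ_{i=1}^d ḡ_{s,i}²/a_{s,i} + 3·G·log(T/δ). -/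
open MeasureTheory Finset Real

/-- The chord bound for the exponential on `[-b, b]`. -/
lemma exp_le_cosh_add_mul_sinh_div {y b : ℝ} (h : |y| ≤ b) :
    Real.exp y ≤ Real.cosh b + Real.sinh b / b * y := by
  rcases (abs_nonneg y |>.trans h).eq_or_lt with rfl | hb
  · simp [abs_nonpos_iff.1 h]
  obtain ⟨h1, h2⟩ := abs_le.1 h
  have hconv : Real.exp (((b + y) / (2 * b)) • b + ((b - y) / (2 * b)) • (-b)) ≤
      ((b + y) / (2 * b)) • Real.exp b + ((b - y) / (2 * b)) • Real.exp (-b) :=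
    convexOn_exp.2 (Set.mem_univ b) (Set.mem_univ (-b))
      (div_nonneg (by linarith) (by linarith)) (div_nonneg (by linarith) (by linarith))
      (by field_simp; ring)
  have hy : ((b + y) / (2 * b)) • b + ((b - y) / (2 * b)) • (-b) = y := by
    simp only [smul_eq_mul]; field_simp; ring
  rw [hy] at hconv
  refine hconv.trans_eq ?_
  rw [Real.cosh_eq, Real.sinh_eq]
  simp only [smul_eq_mul]
  field_simp
  ring

lemma sinh_mul_exp_neg_half_sq_le_one (b : ℝ) :
    Real.sinh b * Real.exp (-(b ^ 2 / 2)) ≤ 1 := by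
  have h := (Real.sinh_lt_cosh b).le.trans (Real.cosh_le_exp_half_sq b)
  calc Real.sinh b * Real.exp (-(b ^ 2 / 2))
      ≤ Real.exp (b ^ 2 / 2) * Real.exp (-(b ^ 2 / 2)) := by gcongr
    _ = 1 := by rw [← Real.exp_add]; simp

/-- One step of the conditional Hoeffding bound, for a conditionally centred variable `Y` with a
measurable bound `σ`, weighted by `W`. -/
lemma integral_mul_exp_sub_half_sq_le {Ω : Type*} {m m0 : MeasurableSpace Ω} (hm : m ≤ m0)
    {μ : Measure Ω} [IsFiniteMeasure μ] {W Y σ : Ω → ℝ}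
    (hWm : StronglyMeasurable[m] W) (hW0 : ∀ ω, 0 ≤ W ω) (hWi : Integrable W μ)
    (hYi : Integrable Y μ) (hY : μ[Y | m] =ᵐ[μ] 0) (hσm : StronglyMeasurable[m] σ)
    (hYσ : ∀ᵐ ω ∂μ, |Y ω| ≤ σ ω) :
    Integrable (fun ω => W ω * Real.exp (Y ω - σ ω ^ 2 / 2)) μ ∧
      ∫ ω, W ω * Real.exp (Y ω - σ ω ^ 2 / 2) ∂μ ≤ ∫ ω, W ω ∂μ := by
  set h : Ω → ℝ := fun ω =>
    W ω * (Real.sinh (σ ω) * Real.exp (-(σ ω ^ 2 / 2)) / σ ω) with hh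
  have hσ' := hσm.measurable
  have hhm : StronglyMeasurable[m] h := by
    refine hWm.mul (Measurable.stronglyMeasurable ?_)
    exact ((Real.measurable_sinh.comp hσ').mul
      (Real.measurable_exp.comp ((hσ'.pow_const 2).div_const 2).neg)).div hσ'
  have hσ0 := hσm.mono hm
  have hhY : Integrable (h * Y) μ := by
    refine hWi.mono ((hhm.mono hm).aestronglyMeasurable.mul hYi.1) ?_
    filter_upwards [hYσ] with ω hω
    have hb := (abs_nonneg _).trans hω
    simp only [Pi.mul_apply, hh, norm_mul, Real.norm_eq_abs, abs_of_nonneg (hW0 ω), mul_assoc]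
    refine mul_le_of_le_one_right (hW0 ω) ?_
    rcases hb.eq_or_lt with h0 | hpos
    · simp [← h0]
    have hs : 0 ≤ Real.sinh (σ ω) := Real.sinh_nonneg_iff.2 hb
    rw [abs_of_nonneg (by positivity)]
    calc Real.sinh (σ ω) * Real.exp (-(σ ω ^ 2 / 2)) / σ ω * |Y ω|
        ≤ Real.sinh (σ ω) * Real.exp (-(σ ω ^ 2 / 2)) / σ ω * σ ω := by gcongr
      _ = Real.sinh (σ ω) * Real.exp (-(σ ω ^ 2 / 2)) := by field_simp
      _ ≤ 1 := sinh_mul_exp_neg_half_sq_le_one _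
  have hint : ∫ ω, (h * Y) ω ∂μ = 0 := by
    rw [← integral_condExp hm]
    refine integral_eq_zero_of_ae ?_
    filter_upwards [condExp_mul_of_stronglyMeasurable_left hhm hhY hYi, hY] with ω h1 h2
    simp [h1, h2]
  have hle : ∀ᵐ ω ∂μ, W ω * Real.exp (Y ω - σ ω ^ 2 / 2) ≤ W ω + (h * Y) ω := by
    filter_upwards [hYσ] with ω hω
    have h1 := exp_le_cosh_add_mul_sinh_div hω
    have h2 : Real.cosh (σ ω) * Real.exp (-(σ ω ^ 2 / 2)) ≤ 1 := by
      calc _ ≤ Real.exp (σ ω ^ 2 / 2) * Real.exp (-(σ ω ^ 2 / 2)) := by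
            gcongr; exact Real.cosh_le_exp_half_sq _
        _ = 1 := by rw [← Real.exp_add]; simp
    have h3 : Real.exp (Y ω - σ ω ^ 2 / 2) ≤
        1 + Real.sinh (σ ω) * Real.exp (-(σ ω ^ 2 / 2)) / σ ω * Y ω := by
      rw [sub_eq_add_neg, Real.exp_add]
      calc _ ≤ (Real.cosh (σ ω) + Real.sinh (σ ω) / σ ω * Y ω) *
              Real.exp (-(σ ω ^ 2 / 2)) := by gcongr
        _ = Real.cosh (σ ω) * Real.exp (-(σ ω ^ 2 / 2)) +
              Real.sinh (σ ω) * Real.exp (-(σ ω ^ 2 / 2)) / σ ω * Y ω := by ring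
        _ ≤ _ := by gcongr
    calc _ ≤ W ω * (1 + Real.sinh (σ ω) * Real.exp (-(σ ω ^ 2 / 2)) / σ ω * Y ω) :=
          mul_le_mul_of_nonneg_left h3 (hW0 ω)
      _ = _ := by simp only [hh, Pi.mul_apply]; ring
  have hi : Integrable (fun ω => W ω * Real.exp (Y ω - σ ω ^ 2 / 2)) μ := by
    refine (hWi.add hhY).mono ?_ ?_
    · exact hWi.1.mul (Real.continuous_exp.comp_aestronglyMeasurable
        (hYi.1.sub ((hσ0.pow 2).div stronglyMeasurable_const).aestronglyMeasurable))
    · filter_upwards [hle] with ω hω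
      rw [Real.norm_of_nonneg (mul_nonneg (hW0 ω) (Real.exp_pos _).le)]
      exact hω.trans (le_abs_self _)
  refine ⟨hi, (integral_mono_ae hi (hWi.add hhY) hle).trans_eq ?_⟩
  simp only [Pi.add_apply]
  rw [integral_add hWi hhY, hint, add_zero]

/-- Azuma–Hoeffding with predictable bounds: exponential moment of the compensated sums. -/
lemma integral_exp_sum_sub_half_sq_le_one {Ω : Type*} {m0 : MeasurableSpace Ω} {μ : Measure Ω}
    [IsProbabilityMeasure μ] (F : Filtration ℕ m0) {T : ℕ} {Y σ : ℕ → Ω → ℝ}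
    (hYm : ∀ s, 1 ≤ s → s ≤ T → Measurable[F s] (Y s))
    (hYi : ∀ s, 1 ≤ s → s ≤ T → Integrable (Y s) μ)
    (hY : ∀ s, 1 ≤ s → s ≤ T → μ[Y s | F (s - 1)] =ᵐ[μ] 0)
    (hσm : ∀ s, 1 ≤ s → s ≤ T → Measurable[F (s - 1)] (σ s))
    (hYσ : ∀ s, 1 ≤ s → s ≤ T → ∀ᵐ ω ∂μ, |Y s ω| ≤ σ s ω) {t : ℕ} (ht : t ≤ T) :
    Integrable (fun ω => Real.exp (∑ s ∈ Icc 1 t, (Y s ω - σ s ω ^ 2 / 2))) μ ∧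
      ∫ ω, Real.exp (∑ s ∈ Icc 1 t, (Y s ω - σ s ω ^ 2 / 2)) ∂μ ≤ 1 := by
  induction t with
  | zero => simp
  | succ t ih =>
    obtain ⟨hi, hle⟩ := ih (by omega)
    have hm : Measurable[F t] fun ω => Real.exp (∑ s ∈ Icc 1 t, (Y s ω - σ s ω ^ 2 / 2)) := by
      refine Real.measurable_exp.comp (Finset.measurable_fun_sum _ fun s hs => ?_)
      obtain ⟨hs1, hst⟩ := Finset.mem_Icc.1 hs
      exact ((hYm s hs1 (by omega)).mono (F.mono hst) le_rfl).sub
        ((((hσm s hs1 (by omega)).mono (F.mono (by omega)) le_rfl).pow_const 2).div_const 2)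
    have h := integral_mul_exp_sub_half_sq_le (F.le t) hm.stronglyMeasurable
      (fun _ => (Real.exp_pos _).le) hi (hYi (t + 1) (by omega) ht) (hY (t + 1) (by omega) ht)
      (hσm (t + 1) (by omega) ht).stronglyMeasurable (hYσ (t + 1) (by omega) ht)
    simp only [← Real.exp_add, ← Finset.sum_Icc_succ_top (Nat.le_add_left 1 t)] at h
    exact ⟨h.1, h.2.trans hle⟩

/-- Azuma–Hoeffding with predictable bounds, uniformly over the times `1, …, T`. -/
lemma one_sub_le_measure_forall_sum_lt {Ω : Type*} {m0 : MeasurableSpace Ω} {μ : Measure Ω}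
    [IsProbabilityMeasure μ] (F : Filtration ℕ m0) {T : ℕ} (hT : 1 ≤ T) {δ : ℝ} (hδ : 0 < δ)
    {Y σ : ℕ → Ω → ℝ}
    (hYm : ∀ s, 1 ≤ s → s ≤ T → Measurable[F s] (Y s))
    (hYi : ∀ s, 1 ≤ s → s ≤ T → Integrable (Y s) μ)
    (hY : ∀ s, 1 ≤ s → s ≤ T → μ[Y s | F (s - 1)] =ᵐ[μ] 0)
    (hσm : ∀ s, 1 ≤ s → s ≤ T → Measurable[F (s - 1)] (σ s))
    (hYσ : ∀ s, 1 ≤ s → s ≤ T → ∀ᵐ ω ∂μ, |Y s ω| ≤ σ s ω) :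
    ENNReal.ofReal (1 - δ) ≤ μ {ω | ∀ t ∈ Icc 1 T,
      ∑ s ∈ Icc 1 t, (Y s ω - σ s ω ^ 2 / 2) < Real.log (T / δ)} := by
  have hT0 : (0 : ℝ) < T := by exact_mod_cast hT
  set bad : ℕ → Set Ω := fun t =>
    {ω | T / δ ≤ Real.exp (∑ s ∈ Icc 1 t, (Y s ω - σ s ω ^ 2 / 2))} with hbad
  set good := {ω | ∀ t ∈ Icc 1 T,
    ∑ s ∈ Icc 1 t, (Y s ω - σ s ω ^ 2 / 2) < Real.log (T / δ)} with hgood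
  have hone : ∀ t ∈ Icc 1 T, μ (bad t) ≤ ENNReal.ofReal (δ / T) := by
    intro t ht
    obtain ⟨hi, hle⟩ :=
      integral_exp_sum_sub_half_sq_le_one F hYm hYi hY hσm hYσ (Finset.mem_Icc.1 ht).2
    have hmk := (mul_meas_ge_le_integral_of_nonneg
      (Filter.Eventually.of_forall fun _ => (Real.exp_pos _).le) hi (T / δ)).trans hle
    rw [← ENNReal.ofReal_toReal (measure_ne_top μ (bad t))]
    refine ENNReal.ofReal_le_ofReal ?_
    rw [le_div_iff₀ hT0]
    rw [div_mul_eq_mul_div, div_le_one hδ, mul_comm] at hmk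
    exact hmk
  have hunion : μ (⋃ t ∈ Icc 1 T, bad t) ≤ ENNReal.ofReal δ := by
    refine (measure_biUnion_finset_le _ _).trans ((Finset.sum_le_sum hone).trans_eq ?_)
    rw [Finset.sum_const, Nat.card_Icc, Nat.add_sub_cancel, nsmul_eq_mul,
      ← ENNReal.ofReal_natCast, ← ENNReal.ofReal_mul hT0.le]
    congr 1
    field_simp
  have hcover : (Set.univ : Set Ω) ⊆ good ∪ ⋃ t ∈ Icc 1 T, bad t := by
    intro ω _
    by_cases hω : ω ∈ good
    · exact Or.inl hω
    · right
      simp only [hgood, Set.mem_ofPred_eq, not_forall, not_lt] at hω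
      obtain ⟨t, ht, hle⟩ := hω
      exact Set.mem_biUnion ht ((Real.log_le_iff_le_exp (by positivity)).1 hle)
  have htot : (1 : ENNReal) ≤ μ good + ENNReal.ofReal δ := by
    calc (1 : ENNReal) = μ Set.univ := measure_univ.symm
      _ ≤ _ := measure_mono hcover
      _ ≤ _ := measure_union_le _ _
      _ ≤ _ := by gcongr
  rw [ENNReal.ofReal_sub _ hδ.le, ENNReal.ofReal_one]
  exact tsub_le_iff_right.2 htot

/-- A function with `L`-Lipschitz gradient and lower bound `c` satisfies
`‖∇f‖² ≤ 4 L (f - c)`. -/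
lemma norm_sq_gradient_le {E : Type*} [NormedAddCommGroup E] [InnerProductSpace ℝ E]
    [CompleteSpace E] {f : E → ℝ} {f' : E → E} (hf : ∀ p, HasGradientAt f (f' p) p)
    {L : ℝ} (hL : 0 < L) (hLip : ∀ p q, ‖f' p - f' q‖ ≤ L * ‖p - q‖)
    {c : ℝ} (hc : ∀ p, c ≤ f p) (p : E) : ‖f' p‖ ^ 2 ≤ 4 * L * (f p - c) := by
  set r : ℝ := 1 / (2 * L) with hr
  have hr0 : 0 < r := by positivity
  have hd : ∀ t : ℝ, HasDerivAt (fun t : ℝ => f (p - t • f' p))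
      (inner ℝ (f' (p - t • f' p)) (-f' p)) t := by
    intro t
    have hline : HasDerivAt (fun t : ℝ => p - t • f' p) (-f' p) t := by
      simpa using ((hasDerivAt_id t).smul_const (f' p)).const_sub p
    exact (hf (p - t • f' p)).hasFDerivAt.comp_hasDerivAt t hline
  obtain ⟨t, ⟨ht0, htr⟩, ht⟩ := exists_hasDerivAt_eq_slope (fun t : ℝ => f (p - t • f' p)) _ hr0
    (fun t _ => (hd t).continuousAt.continuousWithinAt) (fun t _ => hd t)
  have hdiff : ‖f' (p - t • f' p) - f' p‖ ≤ L * (r * ‖f' p‖) := by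
    refine (hLip _ _).trans ?_
    have : p - t • f' p - p = -(t • f' p) := by abel
    rw [this, norm_neg, norm_smul, Real.norm_of_nonneg ht0.le]
    gcongr
  have hinner : inner ℝ (f' (p - t • f' p)) (-f' p) ≤ -(‖f' p‖ ^ 2 / 2) := by
    have h1 := real_inner_le_norm (f' (p - t • f' p) - f' p) (-f' p)
    rw [inner_sub_left, inner_neg_right (f' p), real_inner_self_eq_norm_sq, norm_neg] at h1
    have h2 : ‖f' (p - t • f' p) - f' p‖ * ‖f' p‖ ≤ L * (r * ‖f' p‖) * ‖f' p‖ := by gcongr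
    have h3 : L * (r * ‖f' p‖) * ‖f' p‖ = ‖f' p‖ ^ 2 / 2 := by rw [hr]; field_simp
    linarith
  have hlow := hc (p - r • f' p)
  rw [ht, sub_zero, zero_smul, sub_zero, div_le_iff₀ hr0] at hinner
  have h4 : -(‖f' p‖ ^ 2 / 2) * r = -(‖f' p‖ ^ 2 / (4 * L)) := by rw [hr]; field_simp; ring
  have h5 : ‖f' p‖ ^ 2 / (4 * L) ≤ f p - c := by linarith
  rw [div_le_iff₀ (by positivity)] at h5
  linarith

/-- Cauchy–Schwarz for a diagonally weighted inner product whose weights are at least `c`. -/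
lemma sq_sum_mul_div_le {ι : Type*} [Fintype ι] (p q : EuclideanSpace ℝ ι) {a : ι → ℝ} {c : ℝ}
    (hc : 0 < c) (ha : ∀ i, c ≤ a i) :
    (∑ i, p i * q i / a i) ^ 2 ≤ (∑ i, p i ^ 2 / a i) * (‖q‖ ^ 2 / c) := by
  have ha0 : ∀ i, 0 < a i := fun i => hc.trans_le (ha i)
  have hp : ∀ i, 0 ≤ p i ^ 2 / a i := fun i => div_nonneg (sq_nonneg _) (ha0 i).le
  have hq : ∀ i, 0 ≤ q i ^ 2 / a i := fun i => div_nonneg (sq_nonneg _) (ha0 i).le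
  refine (Finset.sum_sq_le_sum_mul_sum_of_sq_le_mul univ (fun i _ => hp i) (fun i _ => hq i)
    (fun i _ => le_of_eq (by have := (ha0 i).ne'; field_simp))).trans ?_
  refine mul_le_mul_of_nonneg_left ?_ (Finset.sum_nonneg fun i _ => hp i)
  rw [EuclideanSpace.real_norm_sq_eq, Finset.sum_div]
  exact Finset.sum_le_sum fun i _ => by gcongr; exact ha i

lemma sum_sq_div_le {ι : Type*} [Fintype ι] (p : EuclideanSpace ℝ ι) {a : ι → ℝ} {c : ℝ}
    (hc : 0 < c) (ha : ∀ i, c ≤ a i) : ∑ i, p i ^ 2 / a i ≤ ‖p‖ ^ 2 / c := by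
  rw [EuclideanSpace.real_norm_sq_eq, Finset.sum_div]
  exact Finset.sum_le_sum fun i _ => by gcongr; exact ha i

lemma EuclideanSpace.measurable_of_forall_apply {Ω ι : Type*} [MeasurableSpace Ω] [Fintype ι]
    {y : Ω → EuclideanSpace ℝ ι} (h : ∀ i, Measurable fun ω => y ω i) : Measurable y :=
  (WithLp.measurable_toLp 2 (ι → ℝ)).comp (measurable_pi_lambda (fun ω i => y ω i) h)

lemma EuclideanSpace.measurable_apply {Ω ι : Type*} [MeasurableSpace Ω] [Fintype ι]
    {y : Ω → EuclideanSpace ℝ ι} (h : Measurable y) (i : ι) : Measurable fun ω => y ω i :=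
  (EuclideanSpace.proj (𝕜 := ℝ) i).continuous.measurable.comp h

/-- The AdaGrad iterates are adapted, the point `x (k + 1)` being known at time `k`. -/
lemma measurable_adagrad_iterates {Ω : Type*} {m0 : MeasurableSpace Ω} (F : Filtration ℕ m0)
    {d : ℕ} {β η ε : ℝ} {T : ℕ} {g v m x : ℕ → Ω → EuclideanSpace ℝ (Fin d)}
    {x1 : EuclideanSpace ℝ (Fin d)} (hx1 : ∀ ω, x 1 ω = x1)
    (hv0 : ∀ ω, v 0 ω = 0) (hm0 : ∀ ω, m 0 ω = 0)
    (hv : ∀ s, 1 ≤ s → ∀ ω i, v s ω i = v (s - 1) ω i + g s ω i ^ 2)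
    (hmrec : ∀ s, 1 ≤ s → ∀ ω i,
      m s ω i = β * m (s - 1) ω i - η * g s ω i / (Real.sqrt (v s ω i) + ε))
    (hxrec : ∀ s, 1 ≤ s → ∀ ω, x (s + 1) ω = x s ω + m s ω)
    (hmeas : ∀ s, 1 ≤ s → s ≤ T → Measurable[F s] (g s)) {k : ℕ} (hk : k ≤ T) :
    Measurable[F k] (v k) ∧ Measurable[F k] (m k) ∧ Measurable[F k] (x (k + 1)) := by
  induction k with
  | zero =>
    refine ⟨?_, ?_, ?_⟩
    · rw [show v 0 = fun _ => 0 from funext hv0]; exact measurable_const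
    · rw [show m 0 = fun _ => 0 from funext hm0]; exact measurable_const
    · rw [zero_add, show x 1 = fun _ => x1 from funext hx1]; exact measurable_const
  | succ k ih =>
    obtain ⟨ihv, ihm, ihx⟩ := ih (by omega)
    have hF := F.mono (Nat.le_succ k)
    have hgi := fun i => @EuclideanSpace.measurable_apply _ _ (F (k + 1)) _ _
      (hmeas (k + 1) (by omega) hk) i
    have hvi : ∀ i, Measurable[F (k + 1)] fun ω => v (k + 1) ω i := by
      intro i
      simp only [hv (k + 1) (by omega), Nat.add_sub_cancel]
      exact (@EuclideanSpace.measurable_apply _ _ (F (k + 1)) _ _ (ihv.mono hF le_rfl) i).add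
        ((hgi i).pow_const 2)
    have hmi : ∀ i, Measurable[F (k + 1)] fun ω => m (k + 1) ω i := by
      intro i
      simp only [hmrec (k + 1) (by omega), Nat.add_sub_cancel]
      exact ((@EuclideanSpace.measurable_apply _ _ (F (k + 1)) _ _ (ihm.mono hF le_rfl)
        i).const_mul β).sub (((hgi i).const_mul η).div
          ((Real.continuous_sqrt.measurable.comp (hvi i)).add_const ε))
    have hm := @EuclideanSpace.measurable_of_forall_apply _ _ (F (k + 1)) _ _ hmi
    refine ⟨@EuclideanSpace.measurable_of_forall_apply _ _ (F (k + 1)) _ _ hvi, hm, ?_⟩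
    rw [show x (k + 1 + 1) = fun ω => x (k + 1) ω + m (k + 1) ω from
      funext (hxrec (k + 1) (by omega))]
    exact (ihx.mono hF le_rfl).add hm

/-- An integrable pairing of a measurable vector field with the deviation of `g` from its
conditional expectation is conditionally centred. -/
lemma condExp_inner_sub_condExp {Ω E : Type*} [NormedAddCommGroup E] [InnerProductSpace ℝ E]
    [CompleteSpace E] {m m0 : MeasurableSpace Ω} (hm : m ≤ m0) {μ : Measure Ω}
    [IsFiniteMeasure μ] {g h u : Ω → E} (hg : Integrable g μ) (hh : StronglyMeasurable[m] h)
    (hgh : μ[g | m] =ᵐ[μ] h) (hu : StronglyMeasurable[m] u)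
    (hi : Integrable (fun ω => (inner ℝ (u ω) (g ω - h ω) : ℝ)) μ) :
    μ[fun ω => (inner ℝ (u ω) (g ω - h ω) : ℝ) | m] =ᵐ[μ] 0 := by
  have hhi : Integrable h μ := integrable_condExp.congr hgh
  have h1 := condExp_bilin_of_stronglyMeasurable_left (innerSL ℝ) hu hi (hg.sub hhi)
  filter_upwards [h1, condExp_sub hg hhi m, hgh,
    (condExp_of_stronglyMeasurable hm hh hhi).eventuallyEq] with ω h1 h2 h3 h4
  have h5 : μ[fun ω => g ω - h ω | m] ω = 0 := h2.trans (by simp [h3, h4])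
  refine h1.trans ?_
  simp [h5]

theorem stmt_3
    {Ω : Type*} {m0 : MeasurableSpace Ω} {μ : Measure Ω} [IsProbabilityMeasure μ]
    (F : Filtration ℕ m0)
    {d : ℕ} (β η ε : ℝ) (hβ0 : 0 ≤ β) (hβ1 : β < 1) (hη : 0 < η) (hε : 0 < ε)
    (T : ℕ) (hT : 1 ≤ T) (δ : ℝ) (hδ0 : 0 < δ) (hδ1 : δ < 1)
    (g v m x : ℕ → Ω → EuclideanSpace ℝ (Fin d))
    (x1 : EuclideanSpace ℝ (Fin d)) (hx1 : ∀ ω, x 1 ω = x1)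
    (hv0 : ∀ ω, v 0 ω = 0) (hm0 : ∀ ω, m 0 ω = 0) (hx0 : ∀ ω, x 0 ω = x 1 ω)
    (hv : ∀ s, 1 ≤ s → ∀ ω i, v s ω i = v (s - 1) ω i + g s ω i ^ 2)
    (hmrec : ∀ s, 1 ≤ s → ∀ ω i,
      m s ω i = β * m (s - 1) ω i - η * g s ω i / (Real.sqrt (v s ω i) + ε))
    (hxrec : ∀ s, 1 ≤ s → ∀ ω, x (s + 1) ω = x s ω + m s ω)
    (f : EuclideanSpace ℝ (Fin d) → ℝ) (fgrad : EuclideanSpace ℝ (Fin d) → EuclideanSpace ℝ (Fin d))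
    (hgrad : ∀ p, HasGradientAt f (fgrad p) p)
    (L : ℝ) (hL : 0 < L)
    (hsmooth : ∀ p q, ‖fgrad p - fgrad q‖ ≤ L * ‖p - q‖)
    (fstar : ℝ) (hfstar : ∀ p, fstar ≤ f p)
    (A B C : ℝ) (hA : 0 < A) (hB : 0 < B) (hC : 0 < C)
    (hmeas : ∀ s, 1 ≤ s → s ≤ T → Measurable[F s] (g s))
    (hA2 : ∀ s, 1 ≤ s → s ≤ T → μ[g s | F (s - 1)] =ᵐ[μ] fun ω => fgrad (x s ω))
    (hA3 : ∀ s, 1 ≤ s → s ≤ T → ∀ᵐ ω ∂μ,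
      ‖g s ω - fgrad (x s ω)‖ ^ 2 ≤
        A * (f (x s ω) - fstar) + B * ‖fgrad (x s ω)‖ ^ 2 + C)
    (X Ltil FT Δ G Δ₁ B₁ : ℝ)
    (hX : X = 2 * A + 4 * L * B + 4 * L)
    (hLtil : Ltil = L * η ^ 2 / (2 * (1 - β) ^ 3) + L * η ^ 2 / (2 * (1 - β) ^ 2))
    (hFT : FT = 1 + 1 / ε ^ 2 *
      ((X * (f x1 - fstar) + 2 * C) * (T : ℝ) +
        (η * ‖fgrad x1‖ * Real.sqrt (d : ℝ) / (1 - β) +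
          L * η ^ 2 * (d : ℝ) / (2 * (1 - β) ^ 2)) * X * (T : ℝ) ^ 2 +
        L * η ^ 2 * (d : ℝ) * X * (T : ℝ) ^ 3 / (1 - β) ^ 2))
    (hΔ : Δ = 4 * (f x1 - fstar) +
      12 * Real.sqrt (2 * C) * η / (1 - β) * Real.log ((T : ℝ) / δ) +
      4 * (Real.sqrt (2 * C) * η / (1 - β) + L * η ^ 2 / (1 - β) ^ 3 + Ltil) * (d : ℝ) *
        Real.log FT +
      72 * X * η ^ 2 / (1 - β) ^ 2 * Real.log ((T : ℝ) / δ) ^ 2 +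
      8 * X * η ^ 2 / (1 - β) ^ 2 * (d : ℝ) ^ 2 * Real.log FT ^ 2)
    (hG : G = Real.sqrt (X * Δ + 2 * C))
    (hΔ₁ : Δ₁ = Δ * (1 - β) / η)
    (hB₁ : B₁ = B + 1)
    (Gs : ℕ → Ω → ℝ)
    (hGs : ∀ s ω, Gs s ω = Real.sqrt (X * (f (x s ω) - fstar) + 2 * C))
    (a : ℕ → Ω → Fin d → ℝ)
    (ha : ∀ s ω i, a s ω i = Real.sqrt (v (s - 1) ω i + Gs s ω ^ 2) + ε)
 :
    ENNReal.ofReal (1 - δ) ≤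
      μ {ω | ∀ t ∈ Finset.Icc 1 T,
        -(∑ s ∈ Finset.Icc 1 t, ∑ i,
            fgrad (x s ω) i * (g s ω i - fgrad (x s ω) i) / a s ω i) ≤
          1 / 4 * ∑ s ∈ Finset.Icc 1 t, Gs s ω / G * ∑ i, fgrad (x s ω) i ^ 2 / a s ω i +
            3 * G * Real.log ((T : ℝ) / δ)} := by
  have hT0 : (1 : ℝ) ≤ T := by exact_mod_cast hT
  have h1β : 0 < 1 - β := by linarith
  have hX0 : 0 < X := by rw [hX]; positivity
  have hgap : ∀ p, 0 ≤ f p - fstar := fun p => sub_nonneg.2 (hfstar p)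
  have hlogT : 0 ≤ Real.log ((T : ℝ) / δ) :=
    Real.log_nonneg (by rw [le_div_iff₀ hδ0]; linarith)
  have hFT1 : 0 ≤ Real.log FT := by
    refine Real.log_nonneg ?_
    rw [hFT, le_add_iff_nonneg_right]
    have := hgap x1
    positivity
  have hΔ0 : 0 ≤ Δ := by
    have := hgap x1
    rw [hΔ, hLtil]
    positivity
  have hG0 : 0 < G := by rw [hG]; positivity
  have hGs0 : ∀ s ω, 0 < Gs s ω := fun s ω => by
    have := hgap (x s ω)
    rw [hGs]; positivity
  have hGssq : ∀ s ω, Gs s ω ^ 2 = X * (f (x s ω) - fstar) + 2 * C := fun s ω => by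
    have := hgap (x s ω)
    rw [hGs, Real.sq_sqrt (by positivity)]
  have hvnn : ∀ s ω i, 0 ≤ v s ω i := by
    intro s ω i
    induction s with
    | zero => simp [hv0]
    | succ s ih =>
      rw [hv (s + 1) (by omega), Nat.add_sub_cancel]
      positivity
  have hGa : ∀ s ω i, Gs s ω ≤ a s ω i := by
    intro s ω i
    rw [ha]
    have : Gs s ω ≤ Real.sqrt (v (s - 1) ω i + Gs s ω ^ 2) :=
      Real.le_sqrt_of_sq_le (le_add_of_nonneg_left (hvnn _ _ _))
    linarith
  have hgradle : ∀ p, ‖fgrad p‖ ^ 2 ≤ 4 * L * (f p - fstar) :=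
    norm_sq_gradient_le hgrad hL hsmooth hfstar
  have hgradG : ∀ s ω, ‖fgrad (x s ω)‖ ^ 2 ≤ Gs s ω ^ 2 := by
    intro s ω
    have h0 := hgap (x s ω)
    have h1 : 0 ≤ (2 * A + 4 * L * B) * (f (x s ω) - fstar) := by positivity
    rw [hGssq, hX]
    linarith [hgradle (x s ω)]
  have hnoise : ∀ s, 1 ≤ s → s ≤ T → ∀ᵐ ω ∂μ,
      ‖g s ω - fgrad (x s ω)‖ ^ 2 ≤ Gs s ω ^ 2 := by
    intro s h1 h2
    filter_upwards [hA3 s h1 h2] with ω hω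
    have h0 := hgap (x s ω)
    have h3 : 0 ≤ (A + 4 * L) * (f (x s ω) - fstar) := by positivity
    have h4 := mul_le_mul_of_nonneg_left (hgradle (x s ω)) hB.le
    rw [hGssq, hX]
    linarith
  have hfgradc : Continuous fgrad :=
    (LipschitzWith.of_dist_le_mul (K := L.toNNReal) fun p q => by
      rw [dist_eq_norm, dist_eq_norm, Real.coe_toNNReal _ hL.le]; exact hsmooth p q).continuous
  have hfc : Continuous f :=
    continuous_iff_continuousAt.2 fun p => (hgrad p).hasFDerivAt.continuousAt
  have hvm : ∀ s, 1 ≤ s → s ≤ T → Measurable[F (s - 1)] (v (s - 1)) := fun s _ h2 =>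
    (measurable_adagrad_iterates F hx1 hv0 hm0 hv hmrec hxrec hmeas
      (k := s - 1) (by omega)).1
  have hxm : ∀ s, 1 ≤ s → s ≤ T → Measurable[F (s - 1)] (x s) := by
    intro s h1 h2
    have h := (measurable_adagrad_iterates F hx1 hv0 hm0 hv hmrec hxrec hmeas
      (k := s - 1) (by omega)).2.2
    rwa [Nat.sub_add_cancel h1] at h
  have hgm : ∀ s, 1 ≤ s → s ≤ T → Measurable[F (s - 1)] fun ω => fgrad (x s ω) :=
    fun s h1 h2 => hfgradc.measurable.comp (hxm s h1 h2)
  have hgim : ∀ s, 1 ≤ s → s ≤ T → ∀ i, Measurable[F (s - 1)] fun ω => fgrad (x s ω) i :=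
    fun s h1 h2 i => @EuclideanSpace.measurable_apply _ _ (F (s - 1)) _ _ (hgm s h1 h2) i
  have hGsm : ∀ s, 1 ≤ s → s ≤ T → Measurable[F (s - 1)] (Gs s) := by
    intro s h1 h2
    rw [show Gs s = fun ω => Real.sqrt (X * (f (x s ω) - fstar) + 2 * C) from funext (hGs s)]
    exact Real.continuous_sqrt.measurable.comp
      ((((hfc.measurable.comp (hxm s h1 h2)).sub_const fstar).const_mul X).add_const (2 * C))
  have ham : ∀ s, 1 ≤ s → s ≤ T → ∀ i, Measurable[F (s - 1)] fun ω => a s ω i := by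
    intro s h1 h2 i
    simp only [ha]
    exact (Real.continuous_sqrt.measurable.comp
      ((@EuclideanSpace.measurable_apply _ _ (F (s - 1)) _ _ (hvm s h1 h2) i).add
        ((hGsm s h1 h2).pow_const 2))).add_const ε
  set r : ℝ := 1 / (3 * G) with hr
  have hr0 : 0 < r := by positivity
  set u : ℕ → Ω → EuclideanSpace ℝ (Fin d) := fun s ω =>
    WithLp.toLp 2 fun i => -(r * (fgrad (x s ω) i / a s ω i)) with hu
  set Y : ℕ → Ω → ℝ := fun s ω => inner ℝ (u s ω) (g s ω - fgrad (x s ω)) with hYdef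
  set q : ℕ → Ω → ℝ := fun s ω => ∑ i, fgrad (x s ω) i ^ 2 / a s ω i with hq
  set σ : ℕ → Ω → ℝ := fun s ω => r * Real.sqrt (Gs s ω * q s ω) with hσ
  have hq0 : ∀ s ω, 0 ≤ q s ω := fun s ω =>
    Finset.sum_nonneg fun i _ => div_nonneg (sq_nonneg _) ((hGs0 s ω).le.trans (hGa s ω i))
  have hum : ∀ s, 1 ≤ s → s ≤ T → Measurable[F (s - 1)] (u s) := fun s h1 h2 =>
    @EuclideanSpace.measurable_of_forall_apply _ _ (F (s - 1)) _ _ fun i =>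
      (((hgim s h1 h2 i).div (ham s h1 h2 i)).const_mul r).neg
  have hσm : ∀ s, 1 ≤ s → s ≤ T → Measurable[F (s - 1)] (σ s) := fun s h1 h2 =>
    (Real.continuous_sqrt.measurable.comp ((hGsm s h1 h2).mul
      (Finset.measurable_fun_sum _ fun i _ =>
        ((hgim s h1 h2 i).pow_const 2).div (ham s h1 h2 i)))).const_mul r
  have hYm : ∀ s, 1 ≤ s → s ≤ T → Measurable[F s] (Y s) := fun s h1 h2 =>
    Measurable.inner (𝕜 := ℝ)
      ((hum s h1 h2).mono (F.mono (Nat.sub_le s 1)) le_rfl)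
      ((hmeas s h1 h2).sub ((hgm s h1 h2).mono (F.mono (Nat.sub_le s 1)) le_rfl))
  have hYeq : ∀ s ω, Y s ω =
      -(r * ∑ i, fgrad (x s ω) i * (g s ω i - fgrad (x s ω) i) / a s ω i) := by
    intro s ω
    simp only [hYdef, hu, PiLp.inner_apply, RCLike.inner_apply, conj_trivial, PiLp.sub_apply,
      Finset.mul_sum, ← Finset.sum_neg_distrib]
    exact Finset.sum_congr rfl fun i _ => by ring
  have hYsq : ∀ s ω, Y s ω ^ 2 ≤ r ^ 2 * (q s ω * (‖g s ω - fgrad (x s ω)‖ ^ 2 / Gs s ω)) := by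
    intro s ω
    rw [hYeq, neg_sq, mul_pow]
    exact mul_le_mul_of_nonneg_left
      (sq_sum_mul_div_le (fgrad (x s ω)) (g s ω - fgrad (x s ω)) (hGs0 s ω) (hGa s ω))
      (sq_nonneg r)
  have hYnorm : ∀ s ω, |Y s ω| ≤ r * ‖g s ω - fgrad (x s ω)‖ := by
    intro s ω
    have hG := hGs0 s ω
    refine abs_le_of_sq_le_sq ((hYsq s ω).trans ?_) (by positivity)
    have hqG : q s ω ≤ Gs s ω := by
      refine (sum_sq_div_le _ hG (hGa s ω)).trans ?_
      rw [div_le_iff₀ hG, ← sq]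
      exact hgradG s ω
    calc r ^ 2 * (q s ω * (‖g s ω - fgrad (x s ω)‖ ^ 2 / Gs s ω))
        ≤ r ^ 2 * (Gs s ω * (‖g s ω - fgrad (x s ω)‖ ^ 2 / Gs s ω)) := by gcongr
      _ = _ := by field_simp
  have hYσ : ∀ s, 1 ≤ s → s ≤ T → ∀ᵐ ω ∂μ, |Y s ω| ≤ σ s ω := by
    intro s h1 h2
    filter_upwards [hnoise s h1 h2] with ω hω
    have hG := hGs0 s ω
    have hq := hq0 s ω
    refine abs_le_of_sq_le_sq ((hYsq s ω).trans ?_) (by positivity)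
    rw [hσ, mul_pow, Real.sq_sqrt (by positivity)]
    calc r ^ 2 * (q s ω * (‖g s ω - fgrad (x s ω)‖ ^ 2 / Gs s ω))
        ≤ r ^ 2 * (q s ω * (Gs s ω ^ 2 / Gs s ω)) := by gcongr
      _ = _ := by field_simp
  have hcentred : ∀ s, 1 ≤ s → s ≤ T → Integrable (Y s) μ ∧ μ[Y s | F (s - 1)] =ᵐ[μ] 0 := by
    intro s h1 h2
    by_cases hgi : Integrable (g s) μ
    · have hi : Integrable (Y s) μ := by
        refine ((hgi.sub (integrable_condExp.congr (hA2 s h1 h2))).norm.const_mul r).mono'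
          ((hYm s h1 h2).mono (F.le s) le_rfl).aestronglyMeasurable ?_
        exact Filter.Eventually.of_forall fun ω => hYnorm s ω
      exact ⟨hi, condExp_inner_sub_condExp (F.le _) hgi (hgm s h1 h2).stronglyMeasurable
        (hA2 s h1 h2) (hum s h1 h2).stronglyMeasurable hi⟩
    · have hY0 : Y s =ᵐ[μ] 0 := by
        filter_upwards [hA2 s h1 h2] with ω hω
        rw [condExp_of_not_integrable hgi] at hω
        simp [hYeq, ← hω]
      refine ⟨(integrable_zero _ _ _).congr hY0.symm, (condExp_congr_ae hY0).trans ?_⟩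
      rw [condExp_zero]
  refine (one_sub_le_measure_forall_sum_lt F hT hδ0 hYm (fun s h1 h2 => (hcentred s h1 h2).1)
    (fun s h1 h2 => (hcentred s h1 h2).2) hσm hYσ).trans (measure_mono fun ω hω t ht => ?_)
  have hlt := hω t ht
  have hσsq : ∀ s, σ s ω ^ 2 / 2 = r * (1 / 6 * (Gs s ω / G * q s ω)) := by
    intro s
    rw [hσ, mul_pow, Real.sq_sqrt (mul_nonneg (hGs0 s ω).le (hq0 s ω)), hr]
    field_simp
    ring
  simp only [hYeq, hσsq] at hlt
  rw [Finset.sum_sub_distrib, Finset.sum_neg_distrib, ← Finset.mul_sum, ← Finset.mul_sum,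
    ← Finset.mul_sum] at hlt
  have hQ : 0 ≤ ∑ s ∈ Icc 1 t, Gs s ω / G * q s ω := Finset.sum_nonneg fun s _ =>
    mul_nonneg (div_nonneg (hGs0 s ω).le hG0.le) (hq0 s ω)
  set P := ∑ s ∈ Icc 1 t, ∑ i, fgrad (x s ω) i * (g s ω i - fgrad (x s ω) i) / a s ω i
  set Q := ∑ s ∈ Icc 1 t, Gs s ω / G * q s ω
  have hscale : -P - 1 / 6 * Q < 3 * G * Real.log ((T : ℝ) / δ) := by
    have h3 := mul_lt_mul_of_pos_left hlt (show 0 < 3 * G by positivity)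
    have h4 : 3 * G * (-(r * P) - r * (1 / 6 * Q)) = -P - 1 / 6 * Q := by
      rw [hr]; field_simp
    rwa [h4] at h3
  linarith
end

section
/- For the AdaGrad-with-momentum iterates with f L-smooth, for any t ≥ 1 and β ∈ [0,1): Σ_{s=1}^t ⟨∇f(x_s) − ∇f(y_s), g_s/b_s⟩ ≤ (L/(2η))·Σ_{s=1}^t ‖m_{s−1}‖² + (Lη/(2(1−β)²))·Σ_{s=1}^t Σ_{i=1}^d g_{s,i}²/b_{s,i}², where g_s/b_s denotes the coordinatewise quotient. -/
open MeasureTheory Finset Real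

/-- Cauchy–Schwarz in coordinates. -/
theorem EuclideanSpace.sum_mul_le_norm_mul_sqrt {ι : Type*} [Fintype ι]
    (p : EuclideanSpace ℝ ι) (u : ι → ℝ) :
    ∑ i, p i * u i ≤ ‖p‖ * √(∑ i, u i ^ 2) := by
  rw [EuclideanSpace.norm_eq]
  simpa only [Real.norm_eq_abs, sq_abs] using
    Real.sum_mul_le_sqrt_mul_sqrt Finset.univ (fun i => p i) u

/-- Young's inequality for the momentum cross term. -/
theorem momentum_young {β η L M U : ℝ} (hβ0 : 0 ≤ β) (hβ1 : β < 1) (hη : 0 < η) (hL : 0 ≤ L) :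
    L * (β / (1 - β) * M) * U ≤ L / (2 * η) * M ^ 2 + L * η / (2 * (1 - β) ^ 2) * U ^ 2 := by
  have h1 : 0 < 1 - β := by linarith
  have hβ : β ^ 2 ≤ 1 := by nlinarith
  have key : L / (2 * η) * M ^ 2 + L * η / (2 * (1 - β) ^ 2) * U ^ 2 - L * (β / (1 - β) * M) * U
      = L / (2 * η) * ((M - η * (β / (1 - β)) * U) ^ 2)
        + L * η / (2 * (1 - β) ^ 2) * U ^ 2 * (1 - β ^ 2) := by
    field_simp
    ring
  have h2 : 0 ≤ 1 - β ^ 2 := by linarith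
  have h3 : 0 ≤ L / (2 * η) * ((M - η * (β / (1 - β)) * U) ^ 2)
      + L * η / (2 * (1 - β) ^ 2) * U ^ 2 * (1 - β ^ 2) := by positivity
  linarith

theorem stmt_8
    {d : ℕ} (β η ε : ℝ) (hβ0 : 0 ≤ β) (hβ1 : β < 1) (hη : 0 < η) (hε : 0 < ε)
    (g v m x : ℕ → EuclideanSpace ℝ (Fin d))
    (hv0 : v 0 = 0) (hm0 : m 0 = 0) (hx0 : x 0 = x 1)
    (hv : ∀ s, 1 ≤ s → ∀ i, v s i = v (s - 1) i + g s i ^ 2)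
    (hmrec : ∀ s, 1 ≤ s → ∀ i,
      m s i = β * m (s - 1) i - η * g s i / (Real.sqrt (v s i) + ε))
    (hxrec : ∀ s, 1 ≤ s → x (s + 1) = x s + m s)
    (f : EuclideanSpace ℝ (Fin d) → ℝ) (fgrad : EuclideanSpace ℝ (Fin d) → EuclideanSpace ℝ (Fin d))
    (hgrad : ∀ p, HasGradientAt f (fgrad p) p)
    (L : ℝ) (hL : 0 < L)
    (hsmooth : ∀ p q, ‖fgrad p - fgrad q‖ ≤ L * ‖p - q‖)
    (b : ℕ → Fin d → ℝ)
    (hb : ∀ s i, b s i = Real.sqrt (v s i) + ε)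
    (y : ℕ → EuclideanSpace ℝ (Fin d))
    (hy1 : y 1 = x 1)
    (hy : ∀ s, 2 ≤ s → y s = x s + (β / (1 - β)) • (x s - x (s - 1)))
 :
    ∀ t, 1 ≤ t →
      ∑ s ∈ Finset.Icc 1 t, ∑ i, (fgrad (x s) i - fgrad (y s) i) * (g s i / b s i) ≤
        L / (2 * η) * ∑ s ∈ Finset.Icc 1 t, ‖m (s - 1)‖ ^ 2 +
          L * η / (2 * (1 - β) ^ 2) * ∑ s ∈ Finset.Icc 1 t, ∑ i, g s i ^ 2 / b s i ^ 2 := by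
  intro t _
  rw [Finset.mul_sum, Finset.mul_sum, ← Finset.sum_add_distrib]
  refine Finset.sum_le_sum fun s hs => ?_
  have hs1 : 1 ≤ s := (Finset.mem_Icc.mp hs).1
  have h1 : 0 < 1 - β := by linarith
  have hyx : y s = x s + (β / (1 - β)) • m (s - 1) := by
    obtain rfl | h2 := hs1.eq_or_lt
    · simp [hy1, hm0]
    · have hx := hxrec (s - 1) (by omega)
      rw [Nat.sub_add_cancel hs1] at hx
      rw [hy s h2, hx, add_sub_cancel_left]
  have hdist : ‖x s - y s‖ = β / (1 - β) * ‖m (s - 1)‖ := by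
    rw [hyx, norm_sub_rev, add_sub_cancel_left, norm_smul, Real.norm_of_nonneg (by positivity)]
  have hsq : √(∑ i, (g s i / b s i) ^ 2) ^ 2 = ∑ i, g s i ^ 2 / b s i ^ 2 := by
    rw [Real.sq_sqrt (by positivity)]
    simp only [div_pow]
  calc ∑ i, (fgrad (x s) i - fgrad (y s) i) * (g s i / b s i)
      ≤ ‖fgrad (x s) - fgrad (y s)‖ * √(∑ i, (g s i / b s i) ^ 2) :=
        EuclideanSpace.sum_mul_le_norm_mul_sqrt (fgrad (x s) - fgrad (y s)) _
    _ ≤ L * (β / (1 - β) * ‖m (s - 1)‖) * √(∑ i, (g s i / b s i) ^ 2) := by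
        gcongr
        exact hdist ▸ hsmooth (x s) (y s)
    _ ≤ _ := hsq ▸ momentum_young hβ0 hβ1 hη hL.le
end

section
/- For the AdaGrad-with-momentum iterates with f L-smooth and bounded below by f*, β ∈ [0,1), for every s ≥ 1: f(y_s) − f* ≥ (f(x_s) − f*)/2 − L‖m_{s−1}‖²/(2(1−β)²). -/
open MeasureTheory Finset Real

/-- The symmetric second difference of a function with `L`-Lipschitz gradient is at most
`L * ‖h‖ ^ 2`. -/
theorem add_add_sub_le_of_lipschitz_gradient {E : Type*} [NormedAddCommGroup E]
    [InnerProductSpace ℝ E] [CompleteSpace E] {f : E → ℝ} {f' : E → E} {L : ℝ}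
    (hf : ∀ p, HasGradientAt f (f' p) p) (hL : ∀ p q, ‖f' p - f' q‖ ≤ L * ‖p - q‖) (p h : E) :
    f (p + h) + f (p - h) ≤ 2 * f p + L * ‖h‖ ^ 2 := by
  have hline (c t : ℝ) :
      HasDerivAt (fun t : ℝ => f (p + (c * t) • h)) (c * inner ℝ (f' (p + (c * t) • h)) h) t := by
    have hpath : HasDerivAt (fun t : ℝ => p + (c * t) • h) (c • h) t := by
      simpa using (((hasDerivAt_id t).const_mul c).smul_const h).const_add p
    simpa [Function.comp_def] using (hf _).hasFDerivAt.comp_hasDerivAt t hpath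
  have hderiv (t : ℝ) := ((hline 1 t).add (hline (-1) t)).sub
    (((hasDerivAt_id t).pow 2).const_mul (L * ‖h‖ ^ 2))
  have hanti := antitoneOn_of_hasDerivWithinAt_nonpos (convex_Ici (0 : ℝ))
    (fun t _ => (hderiv t).continuousAt.continuousWithinAt)
    (fun t _ => (hderiv t).hasDerivWithinAt) (fun t ht => by
      rw [interior_Ici, Set.mem_Ioi] at ht
      have hinner := real_inner_le_norm (f' (p + (1 * t) • h) - f' (p + (-1 * t) • h)) h
      have hdist : ‖(p + (1 * t) • h) - (p + (-1 * t) • h)‖ = 2 * t * ‖h‖ := by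
        rw [show (p + (1 * t) • h) - (p + (-1 * t) • h) = (2 * t) • h by module, norm_smul,
          Real.norm_of_nonneg (by positivity)]
      have hlip := mul_le_mul_of_nonneg_right (hL (p + (1 * t) • h) (p + (-1 * t) • h))
        (norm_nonneg h)
      rw [hdist] at hlip
      rw [inner_sub_left] at hinner
      norm_num
      norm_num at hinner hlip
      linarith)
  have hle := hanti (Set.mem_Ici.2 le_rfl) (Set.mem_Ici.2 zero_le_one) zero_le_one
  simp [← sub_eq_add_neg] at hle
  linarith

theorem stmt_9
    {d : ℕ} (β η ε : ℝ) (hβ0 : 0 ≤ β) (hβ1 : β < 1) (hη : 0 < η) (hε : 0 < ε)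
    (g v m x : ℕ → EuclideanSpace ℝ (Fin d))
    (hv0 : v 0 = 0) (hm0 : m 0 = 0) (hx0 : x 0 = x 1)
    (hv : ∀ s, 1 ≤ s → ∀ i, v s i = v (s - 1) i + g s i ^ 2)
    (hmrec : ∀ s, 1 ≤ s → ∀ i,
      m s i = β * m (s - 1) i - η * g s i / (Real.sqrt (v s i) + ε))
    (hxrec : ∀ s, 1 ≤ s → x (s + 1) = x s + m s)
    (f : EuclideanSpace ℝ (Fin d) → ℝ) (fgrad : EuclideanSpace ℝ (Fin d) → EuclideanSpace ℝ (Fin d))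
    (hgrad : ∀ p, HasGradientAt f (fgrad p) p)
    (L : ℝ) (hL : 0 < L)
    (hsmooth : ∀ p q, ‖fgrad p - fgrad q‖ ≤ L * ‖p - q‖)
    (fstar : ℝ) (hfstar : ∀ p, fstar ≤ f p)
    (y : ℕ → EuclideanSpace ℝ (Fin d))
    (hy1 : y 1 = x 1)
    (hy : ∀ s, 2 ≤ s → y s = x s + (β / (1 - β)) • (x s - x (s - 1)))
 :
    ∀ s, 1 ≤ s →
      f (y s) - fstar ≥ (f (x s) - fstar) / 2 - L * ‖m (s - 1)‖ ^ 2 / (2 * (1 - β) ^ 2) := by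
  intro s hs
  obtain rfl | hs2 := hs.eq_or_lt
  · have := hfstar (x 1)
    simp [hm0, hy1]
    linarith
  have hx : x s = x (s - 1) + m (s - 1) := by
    simpa [Nat.sub_add_cancel hs] using hxrec (s - 1) (by omega)
  have hβ : 0 < 1 - β := by linarith
  have hdiff : x s - y s = -((β / (1 - β)) • m (s - 1)) := by
    rw [hy s hs2, show x s - x (s - 1) = m (s - 1) by rw [hx]; abel]
    abel
  have hnorm : ‖x s - y s‖ ^ 2 ≤ ‖m (s - 1)‖ ^ 2 / (1 - β) ^ 2 := by
    rw [← div_pow, hdiff, norm_neg, norm_smul, Real.norm_of_nonneg (by positivity),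
      div_mul_eq_mul_div]
    gcongr
    exact mul_le_of_le_one_left (norm_nonneg _) hβ1.le
  have hsecond := add_add_sub_le_of_lipschitz_gradient hgrad hsmooth (y s) (x s - y s)
  rw [add_sub_cancel] at hsecond
  have hlow := hfstar (y s - (x s - y s))
  have hscaled := mul_le_mul_of_nonneg_left hnorm hL.le
  have hsplit : L * ‖m (s - 1)‖ ^ 2 / (2 * (1 - β) ^ 2) =
      L * (‖m (s - 1)‖ ^ 2 / (1 - β) ^ 2) / 2 := by
    field_simp
  rw [hsplit]
  linarith
end
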